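/- arXiv:0803.0998 — 2 statements merged into one kernel-verified Lean document; each statement's English description precedes it below -/
import Mathlib

section
/- Let R be a commutative noetherian ring and C a semidualizing R-module. The class of G_C-flat R-modules is closed under extensions, kernels of epimorphisms, and direct summands: for every short exact sequence 0 → M' → M → M'' → 0 of R-modules, if M' and M'' are G_C-flat then M is G_C-flat, and if M and M'' are G_C-flat then M' is G_C-flat; moreover, every direct summand of a G_C-flat R-module is G_C-flat. -/
open CategoryTheory TensorProduct

universe u

section
variable (R : Type u) [CommRing R]

def extZero (M N : ModuleCat.{u} R) : Prop :=
  ∀ i : ℕ, 1 ≤ i → Subsingleton (((Ext R (ModuleCat.{u} R) i).obj (Opposite.op M)).obj N)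

def torZero (M N : ModuleCat.{u} R) : Prop :=
  ∀ i : ℕ, 1 ≤ i → Subsingleton (((Tor (ModuleCat.{u} R) i).obj M).obj N)

def IsSemidualizing (C : ModuleCat.{u} R) : Prop :=
  Module.Finite R C ∧ Function.Bijective (LinearMap.lsmul R C) ∧ extZero R C C

/-- A module is `C`-flat if it is isomorphic to `F ⊗[R] C` with `F` flat. -/
def IsCFlat (C M : ModuleCat.{u} R) : Prop :=
  ∃ F : ModuleCat.{u} R, Module.Flat R F ∧ Nonempty (M ≃ₗ[R] (F ⊗[R] C))

def IsCInjective (C M : ModuleCat.{u} R) : Prop :=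
  ∃ I : ModuleCat.{u} R, Module.Injective R I ∧ Nonempty (M ≃ₗ[R] (↥C →ₗ[R] ↥I))

/-- cotorsion: `Ext^{≥1}(F, N) = 0` for all flat `F`. -/
def IsCotorsion (N : ModuleCat.{u} R) : Prop :=
  ∀ F : ModuleCat.{u} R, Module.Flat R F → extZero R F N

/-- `C`-cotorsion: `Ext^{≥1}(F ⊗ C, N) = 0` for all flat `F`. -/
def IsCCotorsion (C N : ModuleCat.{u} R) : Prop :=
  ∀ F : ModuleCat.{u} R, Module.Flat R F →
    extZero R (ModuleCat.of R (↥F ⊗[R] ↥C)) N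

/-- `C`-flat `C`-cotorsion: isomorphic to `F ⊗ C` with `F` flat and cotorsion. -/
def IsCFlatCotorsion (C M : ModuleCat.{u} R) : Prop :=
  ∃ F : ModuleCat.{u} R, Module.Flat R F ∧ IsCotorsion R F ∧
    Nonempty (M ≃ₗ[R] (F ⊗[R] C))

/-- The natural evaluation map `C ⊗ Hom(C,M) → M`. -/
noncomputable def evalMap (C M : ModuleCat.{u} R) :
    (↥C ⊗[R] (↥C →ₗ[R] ↥M)) →ₗ[R] ↥M :=
  TensorProduct.lift (LinearMap.id (R := R) (M := ↥C →ₗ[R] ↥M)).flip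

/-- The Bass class `B_C(R)`. -/
noncomputable def InBassClass (C M : ModuleCat.{u} R) : Prop :=
  extZero R C M ∧
  torZero R C (ModuleCat.of R (↥C →ₗ[R] ↥M)) ∧
  Function.Bijective (evalMap R C M)

/-- A `ℤ`-indexed complex of `R`-modules: `d i : X (i+1) → X i`. -/
structure ZComplex where
  X : ℤ → ModuleCat.{u} R
  d : ∀ i : ℤ, ↥(X (i + 1)) →ₗ[R] ↥(X i)
  d_comp_d : ∀ i : ℤ, (d i).comp (d (i + 1)) = 0

namespace ZComplex

variable {R} (Z : ZComplex R)

/-- Exactness of the complex. -/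
def IsExact : Prop := ∀ i : ℤ, Function.Exact (Z.d (i + 1)) (Z.d i)

/-- Exactness of `Z ⊗[R] J`. -/
def TensorExact (J : ModuleCat.{u} R) : Prop :=
  ∀ i : ℤ, Function.Exact (LinearMap.rTensor (↥J) (Z.d (i + 1)))
    (LinearMap.rTensor (↥J) (Z.d i))

/-- Exactness of `Hom_R(V, Z)`. -/
def HomFromExact (V : ModuleCat.{u} R) : Prop :=
  ∀ i : ℤ, Function.Exact
    (fun f : ↥V →ₗ[R] ↥(Z.X (i + 1 + 1)) => (Z.d (i + 1)).comp f)
    (fun f : ↥V →ₗ[R] ↥(Z.X (i + 1)) => (Z.d i).comp f)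

/-- Exactness of `Hom_R(Z, V)`. -/
def HomToExact (V : ModuleCat.{u} R) : Prop :=
  ∀ i : ℤ, Function.Exact
    (fun g : ↥(Z.X i) →ₗ[R] ↥V => g.comp (Z.d i))
    (fun g : ↥(Z.X (i + 1)) →ₗ[R] ↥V => g.comp (Z.d (i + 1)))

/-- `M ≅ Coker(∂₁)`. -/
def IsCokerOfD1 (M : ModuleCat.{u} R) : Prop :=
  Nonempty (↥M ≃ₗ[R] (↥(Z.X 0) ⧸ LinearMap.range (Z.d 0)))

end ZComplex

end

section
variable (R : Type u) [CommRing R]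

/-- A complete `FF_C`-resolution witnessing that `M` is `G_C`-flat. -/
def IsGCFlat (C M : ModuleCat.{u} R) : Prop :=
  ∃ Z : ZComplex R, Z.IsExact ∧
    (∀ i : ℤ, 0 ≤ i → Module.Flat R (Z.X i)) ∧
    (∀ i : ℤ, i < 0 → IsCFlat R C (Z.X i)) ∧
    (∀ J : ModuleCat.{u} R, IsCInjective R C J → Z.TensorExact J) ∧
    Z.IsCokerOfD1 M

def IsCProjective (C M : ModuleCat.{u} R) : Prop :=
  ∃ P : ModuleCat.{u} R, Module.Projective R P ∧ Nonempty (M ≃ₗ[R] (P ⊗[R] C))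

/-- A complete `PP_C`-resolution witnessing that `M` is `G_C`-projective. -/
def IsGCProjective (C M : ModuleCat.{u} R) : Prop :=
  ∃ Z : ZComplex R, Z.IsExact ∧
    (∀ i : ℤ, 0 ≤ i → Module.Projective R (Z.X i)) ∧
    (∀ i : ℤ, i < 0 → IsCProjective R C (Z.X i)) ∧
    (∀ Q : ModuleCat.{u} R, IsCProjective R C Q → Z.HomToExact Q) ∧
    Z.IsCokerOfD1 M

/-- `G(𝒳)` for a class `𝒳` of modules. -/
def GClass (𝒳 : ModuleCat.{u} R → Prop) (M : ModuleCat.{u} R) : Prop :=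
  ∃ Z : ZComplex R, Z.IsExact ∧
    (∀ i : ℤ, 𝒳 (Z.X i)) ∧
    (∀ V : ModuleCat.{u} R, 𝒳 V → Z.HomFromExact V) ∧
    (∀ V : ModuleCat.{u} R, 𝒳 V → Z.HomToExact V) ∧
    Z.IsCokerOfD1 M

/-- Iterates `G^n(𝒳)`, with `G^0(𝒳) = 𝒳`. -/
def GIter : ℕ → (ModuleCat.{u} R → Prop) → (ModuleCat.{u} R → Prop)
  | 0, 𝒳 => 𝒳
  | n + 1, 𝒳 => GClass R (GIter n 𝒳)

/-- `H_C(𝒳)`: modules with a `P_C F_C^cot`-complete `𝒳`-resolution. -/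
def HClass (C : ModuleCat.{u} R) (𝒳 : ModuleCat.{u} R → Prop) (M : ModuleCat.{u} R) : Prop :=
  ∃ Z : ZComplex R, Z.IsExact ∧
    (∀ i : ℤ, 𝒳 (Z.X i)) ∧
    (∀ P : ModuleCat.{u} R, Module.Projective R P →
      Z.HomFromExact (ModuleCat.of R (↥P ⊗[R] ↥C))) ∧
    (∀ N : ModuleCat.{u} R, IsCFlatCotorsion R C N → Z.HomToExact N) ∧
    Z.IsCokerOfD1 M

/-- Iterates `H_C^n(𝒳)`, with `H_C^0(𝒳) = 𝒳`. -/
def HIter (C : ModuleCat.{u} R) : ℕ → (ModuleCat.{u} R → Prop) → (ModuleCat.{u} R → Prop)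
  | 0, 𝒳 => 𝒳
  | n + 1, 𝒳 => HClass R C (HIter C n 𝒳)

/-- `M` admits a resolution `0 → X_n → ⋯ → X_0 → M → 0` with each `X_i` in `𝒳`. -/
def HasResOfLength (𝒳 : ModuleCat.{u} R → Prop) (n : ℕ) (M : ModuleCat.{u} R) : Prop :=
  ∃ (P : ℕ → ModuleCat.{u} R) (d : ∀ i : ℕ, ↥(P (i + 1)) →ₗ[R] ↥(P i))
    (ε : ↥(P 0) →ₗ[R] ↥M),
      Function.Surjective ε ∧ Function.Exact (d 0) ε ∧
      (∀ i : ℕ, Function.Exact (d (i + 1)) (d i)) ∧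
      (∀ i : ℕ, i ≤ n → 𝒳 (P i)) ∧
      (∀ i : ℕ, n < i → Subsingleton (P i))

/-- `M` admits a coresolution `0 → M → Y_0 → ⋯ → Y_n → 0` with each `Y_i` in `𝒳`. -/
def HasCoresOfLength (𝒳 : ModuleCat.{u} R → Prop) (n : ℕ) (M : ModuleCat.{u} R) : Prop :=
  ∃ (P : ℕ → ModuleCat.{u} R) (d : ∀ i : ℕ, ↥(P i) →ₗ[R] ↥(P (i + 1)))
    (η : ↥M →ₗ[R] ↥(P 0)),
      Function.Injective η ∧ Function.Exact η (d 0) ∧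
      (∀ i : ℕ, Function.Exact (d i) (d (i + 1))) ∧
      (∀ i : ℕ, i ≤ n → 𝒳 (P i)) ∧
      (∀ i : ℕ, n < i → Subsingleton (P i))

/-- `C` is a dualizing module: semidualizing of finite injective dimension. -/
def IsDualizing (C : ModuleCat.{u} R) : Prop :=
  IsSemidualizing R C ∧
  ∃ n : ℕ, HasCoresOfLength R (fun I => Module.Injective R ↥I) n C

end

section EvaluationIsomorphism

variable {R : Type u} [CommRing R]

lemma Module.Injective.exists_comp_eq_of_ker_le {X Y E : Type u} [AddCommGroup X] [Module R X]
    [AddCommGroup Y] [Module R Y] [AddCommGroup E] [Module R E] [Module.Injective R E]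
    (u : X →ₗ[R] Y) (h : X →ₗ[R] E) (hle : LinearMap.ker u ≤ LinearMap.ker h) :
    ∃ h' : Y →ₗ[R] E, h'.comp u = h := by
  obtain ⟨h', hh'⟩ := Module.Injective.out ((LinearMap.ker u).liftQ u le_rfl)
    (LinearMap.ker_eq_bot.1 (Submodule.ker_liftQ_eq_bot _ _ _ le_rfl))
    ((LinearMap.ker u).liftQ h hle)
  refine ⟨h', LinearMap.ext fun x => ?_⟩
  simpa using hh' (Submodule.Quotient.mk x)

lemma Module.Injective.of_retract {M N : Type u} [AddCommGroup M] [Module R M]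
    [AddCommGroup N] [Module R N] [Module.Injective R M] (i : N →ₗ[R] M) (r : M →ₗ[R] N)
    (hr : r.comp i = LinearMap.id) : Module.Injective R N where
  out X Y _ _ _ _ f hf g := by
    obtain ⟨h, hh⟩ := Module.Injective.out f hf (i.comp g)
    refine ⟨r.comp h, fun x => ?_⟩
    simpa [hh x] using LinearMap.congr_fun hr (g x)

/-- The evaluation map `A ⊗ Hom(B, E) → Hom(Hom(A, B), E)`. -/
noncomputable def homEvaluation (A B E : Type u) [AddCommGroup A] [Module R A] [AddCommGroup B]
    [Module R B] [AddCommGroup E] [Module R E] :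
    A ⊗[R] (B →ₗ[R] E) →ₗ[R] ((A →ₗ[R] B) →ₗ[R] E) :=
  TensorProduct.lift
    (LinearMap.mk₂ R (fun a φ => φ.comp (LinearMap.applyₗ a)) (by intros; ext; simp)
      (by intros; ext; simp) (by intros; ext; simp) (by intros; ext; simp))

variable {A A' B E : Type u} [AddCommGroup A] [Module R A] [AddCommGroup A'] [Module R A']
  [AddCommGroup B] [Module R B] [AddCommGroup E] [Module R E]

@[simp] lemma homEvaluation_tmul (a : A) (φ : B →ₗ[R] E) (ψ : A →ₗ[R] B) :
    homEvaluation A B E (a ⊗ₜ φ) ψ = φ (ψ a) := rfl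

lemma homEvaluation_rTensor (f : A →ₗ[R] A') (t : A ⊗[R] (B →ₗ[R] E)) :
    homEvaluation A' B E (f.rTensor _ t) = (homEvaluation A B E t).comp (f.lcomp R B) := by
  induction t with
  | zero => simp
  | add x y hx hy => simp [hx, hy, LinearMap.add_comp]
  | tmul a φ => ext; simp

lemma homEvaluation_pi_bijective (n : ℕ) :
    Function.Bijective (homEvaluation (R := R) (Fin n → R) B E) := by
  let c (i : Fin n) : B →ₗ[R] ((Fin n → R) →ₗ[R] B) :=
    LinearMap.smulRightₗ (LinearMap.proj i)
  let ρ : (((Fin n → R) →ₗ[R] B) →ₗ[R] E) → (Fin n → R) ⊗[R] (B →ₗ[R] E) :=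
    fun h => ∑ i, Pi.single i 1 ⊗ₜ h.comp (c i)
  have hx (x : Fin n → R) : ∑ i, x i • (Pi.single i 1 : Fin n → R) = x :=
    (pi_eq_sum_univ' x).symm
  refine Function.bijective_iff_has_inverse.2 ⟨ρ, fun t => ?_, fun h => ?_⟩
  · induction t with
    | zero => simp [ρ]
    | add x y hx hy =>
      simp only [map_add, ρ, LinearMap.add_comp, TensorProduct.tmul_add,
        Finset.sum_add_distrib] at *
      rw [hx, hy]
    | tmul x φ =>
      have (i : Fin n) : (homEvaluation (Fin n → R) B E (x ⊗ₜ φ)).comp (c i) = x i • φ := by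
        ext b; simp [c]
      simp only [ρ, this]
      conv_rhs => rw [← hx x, TensorProduct.sum_tmul]
      simp [TensorProduct.smul_tmul]
  · ext ψ
    simp only [ρ, map_sum, LinearMap.sum_apply, homEvaluation_tmul, LinearMap.comp_apply]
    rw [← map_sum]
    congr 1
    refine LinearMap.ext fun x => ?_
    conv_rhs => rw [← hx x]
    simp [c]

lemma homEvaluation_surjective [Module.Finite R A] [Module.Injective R E] :
    Function.Surjective (homEvaluation (R := R) A B E) := by
  obtain ⟨n, p, hp⟩ := Module.Finite.exists_fin' R A
  intro h
  obtain ⟨k, hk⟩ := Module.Injective.exists_comp_eq_of_ker_le (p.lcomp R B) h (by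
    rw [LinearMap.ker_eq_bot.2 (LinearMap.lcomp_injective_of_surjective p hp)]; exact bot_le)
  obtain ⟨t, rfl⟩ := (homEvaluation_pi_bijective n).2 k
  exact ⟨p.rTensor _ t, by rw [homEvaluation_rTensor, hk]⟩

lemma homEvaluation_bijective [IsNoetherianRing R] [Module.Finite R A] [Module.Injective R E] :
    Function.Bijective (homEvaluation (R := R) A B E) := by
  refine ⟨?_, homEvaluation_surjective⟩
  obtain ⟨n, p, hp⟩ := Module.Finite.exists_fin' R A
  rw [injective_iff_map_eq_zero]
  intro x hx
  obtain ⟨y, rfl⟩ := LinearMap.rTensor_surjective (B →ₗ[R] E) hp x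
  rw [homEvaluation_rTensor] at hx
  obtain ⟨k, hk⟩ := Module.Injective.exists_comp_eq_of_ker_le
    ((LinearMap.ker p).subtype.lcomp R B) (homEvaluation _ B E y) (by
      intro ψ hψ
      obtain ⟨χ, rfl⟩ : ∃ χ : A →ₗ[R] B, χ.comp p = ψ := by
        refine ⟨((LinearMap.ker p).liftQ ψ ?_).comp
          (p.quotKerEquivOfSurjective hp).symm.toLinearMap, ?_⟩
        · intro z hz
          simpa using LinearMap.congr_fun (LinearMap.mem_ker.1 hψ) ⟨z, hz⟩
        · ext z
          simp only [LinearMap.comp_apply, LinearEquiv.coe_coe]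
          have : (p.quotKerEquivOfSurjective hp).symm (p (Pi.single z 1)) =
              Submodule.Quotient.mk (Pi.single z 1) := by
            rw [LinearEquiv.symm_apply_eq]; rfl
          simp [this]
      exact LinearMap.congr_fun hx χ)
  obtain ⟨z, rfl⟩ := homEvaluation_surjective k
  rw [← homEvaluation_rTensor] at hk
  rw [← (homEvaluation_pi_bijective n).1 hk, ← LinearMap.comp_apply, ← LinearMap.rTensor_comp]
  have : p.comp (LinearMap.ker p).subtype = 0 := by ext z; simp
  simp [this]

lemma rTensor_hom_injective_of_lcomp_surjective [IsNoetherianRing R] [Module.Finite R A]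
    [Module.Injective R E] {f : A →ₗ[R] A'} (hf : Function.Surjective (f.lcomp R B)) :
    Function.Injective (f.rTensor (B →ₗ[R] E)) := by
  have : homEvaluation A' B E ∘ f.rTensor (B →ₗ[R] E) =
      (fun φ => φ.comp (f.lcomp R B)) ∘ homEvaluation A B E :=
    funext fun t => homEvaluation_rTensor _ _
  refine Function.Injective.of_comp (f := homEvaluation A' B E) ?_
  rw [this]
  exact hf.injective_linearMapComp_right.comp homEvaluation_bijective.1

end EvaluationIsomorphism

namespace CharacterModule

variable {R : Type u} [CommRing R] {A B D : Type u} [AddCommGroup A] [Module R A]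
  [AddCommGroup B] [Module R B] [AddCommGroup D] [Module R D]

lemma injective_self : Module.Injective R (CharacterModule R) :=
  Module.Flat.iff_characterModule_injective.1 inferInstance

variable (R A) in
/-- The character module of `A` as the module of `R`-linear maps into that of `R`. -/
noncomputable def homSelfEquiv : (A →ₗ[R] CharacterModule R) ≃ₗ[R] CharacterModule A :=
  homEquiv.trans (congr (TensorProduct.rid R A))

lemma flat_of_injective [IsNoetherianRing R] [Module.Injective R A] :
    Module.Flat R (CharacterModule A) := by
  have := injective_self (R := R)
  rw [← Module.Flat.equiv_iff (homSelfEquiv R A), Module.Flat.iff_rTensor_injective']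
  refine fun I => rTensor_hom_injective_of_lcomp_surjective fun g => ?_
  obtain ⟨h, hh⟩ := Module.Injective.out I.subtype I.subtype_injective g
  exact ⟨h, LinearMap.ext hh⟩

lemma nonempty_tensor_equiv [IsNoetherianRing R] [Module.Finite R A] :
    Nonempty (CharacterModule (A →ₗ[R] B) ≃ₗ[R] CharacterModule B ⊗[R] A) := by
  have := injective_self (R := R)
  exact ⟨(homSelfEquiv R (A →ₗ[R] B)).symm ≪≫ₗ
    (LinearEquiv.ofBijective (homEvaluation A B (CharacterModule R))
      homEvaluation_bijective).symm ≪≫ₗ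
    TensorProduct.comm R _ _ ≪≫ₗ (homSelfEquiv R B).rTensor A⟩

lemma dual_exact {f : A →ₗ[R] B} {g : B →ₗ[R] D} (h : Function.Exact f g)
    (hg : Function.Surjective g) : Function.Exact (dual g) (dual f) := by
  intro φ
  constructor
  · intro hφ
    refine ⟨g.toAddMonoidHom.liftOfRightInverse (Function.surjInv hg)
      (Function.rightInverse_surjInv hg) ⟨φ, fun b hb => ?_⟩, ?_⟩
    · obtain ⟨a, rfl⟩ := (h b).1 hb
      exact DFunLike.congr_fun hφ a
    · exact AddMonoidHom.liftOfRightInverse_comp _ _ _ _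
  · rintro ⟨ψ, rfl⟩
    ext a
    change ψ (g (f a)) = 0
    rw [h.apply_apply_eq_zero, map_zero]

/-- The biduality map into the double character module. -/
noncomputable def biduality (R A : Type u) [CommRing R] [AddCommGroup A] [Module R A] :
    A →ₗ[R] CharacterModule (CharacterModule A) :=
  curry ((dual (R := R) (TensorProduct.comm R A (CharacterModule A)).toLinearMap)
    (uncurry LinearMap.id))

@[simp] lemma biduality_apply (a : A) (φ : CharacterModule A) : biduality R A a φ = φ a := rfl

lemma biduality_injective : Function.Injective (biduality R A) := by
  rw [injective_iff_map_eq_zero]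
  intro a ha
  refine eq_zero_of_character_apply fun c => ?_
  rw [← biduality_apply (R := R), ha]; rfl

lemma dual_biduality : (dual (biduality R A)).comp (biduality R (CharacterModule A)) =
    LinearMap.id := by
  ext φ a
  change biduality R (CharacterModule A) φ (biduality R A a) = φ a
  simp

end CharacterModule

section Flat
variable {R : Type u} [CommRing R] {A B D : Type u} [AddCommGroup A] [Module R A]
  [AddCommGroup B] [Module R B] [AddCommGroup D] [Module R D] {f : A →ₗ[R] B} {g : B →ₗ[R] D}

open CharacterModule in
lemma Module.Flat.of_exact_of_dual_section [Module.Flat R B] (h : Function.Exact f g)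
    (hf : Function.Injective f) (hg : Function.Surjective g)
    (hs : ∃ s : CharacterModule A →ₗ[R] CharacterModule B, (dual f).comp s = LinearMap.id) :
    Module.Flat R D := by
  obtain ⟨r, hr⟩ := (((dual_exact h hg).split_tfae (dual_injective_of_surjective g hg)
    (dual_surjective_of_injective f hf)).out 0 1).1 hs
  have := Module.Flat.iff_characterModule_injective.1 ‹Module.Flat R B›
  exact Module.Flat.iff_characterModule_injective.2 (.of_retract _ r hr)

open CharacterModule in
lemma Module.Flat.exists_dual_section [Module.Flat R D] (h : Function.Exact f g)
    (hf : Function.Injective f) (hg : Function.Surjective g) :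
    ∃ s : CharacterModule A →ₗ[R] CharacterModule B, (dual f).comp s = LinearMap.id := by
  have := Module.Flat.iff_characterModule_injective.1 ‹Module.Flat R D›
  obtain ⟨r, hr⟩ := Module.Injective.out (dual g) (dual_injective_of_surjective g hg) LinearMap.id
  have hr' : ∃ l : CharacterModule B →ₗ[R] CharacterModule D, l.comp (dual g) = LinearMap.id :=
    ⟨r, LinearMap.ext hr⟩
  exact (((dual_exact h hg).split_tfae (dual_injective_of_surjective g hg)
    (dual_surjective_of_injective f hf)).out 0 1).2 hr'

open CharacterModule in
lemma Module.Flat.of_exact_of_flat [Module.Flat R B] [Module.Flat R D] (h : Function.Exact f g)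
    (hf : Function.Injective f) (hg : Function.Surjective g) : Module.Flat R A := by
  obtain ⟨s, hs⟩ := Module.Flat.exists_dual_section h hf hg
  have := Module.Flat.iff_characterModule_injective.1 ‹Module.Flat R B›
  exact Module.Flat.iff_characterModule_injective.2 (.of_retract s _ hs)

open CharacterModule in
lemma Module.Flat.rTensor_injective_of_exact [Module.Flat R D] (h : Function.Exact f g)
    (hf : Function.Injective f) (hg : Function.Surjective g)
    (J : Type u) [AddCommGroup J] [Module R J] : Function.Injective (f.rTensor J) := by
  obtain ⟨s, hs⟩ := Module.Flat.exists_dual_section h hf hg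
  rw [← dual_surjective_iff_injective]
  intro c
  refine ⟨dual (TensorProduct.comm R B J).toLinearMap (uncurry (s.comp
    (curry (dual (TensorProduct.comm R J A).toLinearMap c)))), ?_⟩
  refine homEquiv.symm.injective (LinearMap.ext fun a => CharacterModule.ext _ fun j => ?_)
  exact DFunLike.congr_fun (LinearMap.congr_fun hs
    (curry (dual (TensorProduct.comm R J A).toLinearMap c) j)) a

/-- A flat module embeds into its double character module, which is flat, with flat cokernel. -/
lemma Module.Flat.quotient_biduality [IsNoetherianRing R] [Module.Flat R A] :
    Module.Flat R (CharacterModule (CharacterModule A)) ∧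
    Module.Flat R (CharacterModule (CharacterModule A) ⧸
      LinearMap.range (CharacterModule.biduality R A)) := by
  have := Module.Flat.iff_characterModule_injective.1 ‹Module.Flat R A›
  have : Module.Flat R (CharacterModule (CharacterModule A)) := CharacterModule.flat_of_injective
  exact ⟨this, .of_exact_of_dual_section (LinearMap.exact_map_mkQ_range _)
    CharacterModule.biduality_injective (Submodule.mkQ_surjective _)
    ⟨_, CharacterModule.dual_biduality⟩⟩
end Flat

/-- The sequence `0 → A → B → D → 0` with maps `f` and `g` is exact. -/
structure LinearMap.IsShortExact {R : Type u} [CommRing R] {A B D : Type u} [AddCommGroup A]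
    [Module R A] [AddCommGroup B] [Module R B] [AddCommGroup D] [Module R D]
    (f : A →ₗ[R] B) (g : B →ₗ[R] D) : Prop where
  injective : Function.Injective f
  surjective : Function.Surjective g
  exact : Function.Exact f g

/-- All higher extension groups `Ext^n(A, N)`, `n ≥ 1`, vanish. -/
def ExtVanish (R : Type u) [CommRing R] (A N : Type u) [AddCommGroup A] [Module R A]
    [AddCommGroup N] [Module R N] : Prop :=
  ∀ n : ℕ, Subsingleton (Abelian.Ext.{u} (ModuleCat.of R A) (ModuleCat.of R N) (n + 1))

section ExtVanish

variable {R : Type u} [CommRing R] {A B D N : Type u} [AddCommGroup A]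
    [Module R A] [AddCommGroup B] [Module R B] [AddCommGroup D] [Module R D]
    [AddCommGroup N] [Module R N] {f : A →ₗ[R] B} {g : B →ₗ[R] D}

lemma LinearMap.IsShortExact.of_mkQ (hf : Function.Injective f) :
    LinearMap.IsShortExact f (LinearMap.range f).mkQ :=
  ⟨hf, Submodule.mkQ_surjective _, LinearMap.exact_map_mkQ_range f⟩

lemma LinearMap.IsShortExact.of_ker (hg : Function.Surjective g) :
    LinearMap.IsShortExact (LinearMap.ker g).subtype g :=
  ⟨Submodule.subtype_injective _, hg, LinearMap.exact_subtype_ker_map g⟩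

lemma LinearMap.IsShortExact.shortExact (h : LinearMap.IsShortExact f g) :
    (ShortComplex.moduleCatMk f g h.exact.linearMap_comp_eq_zero).ShortExact where
  exact := (ShortComplex.ShortExact.moduleCat_exact_iff_function_exact _).2 h.exact
  mono_f := (ModuleCat.mono_iff_injective _).2 h.injective
  epi_g := (ModuleCat.epi_iff_surjective _).2 h.surjective

namespace ExtVanish

lemma extension (h : LinearMap.IsShortExact f g) (hA : ExtVanish R A N) (hD : ExtVanish R D N) :
    ExtVanish R B N := fun n => by
  refine subsingleton_of_forall_eq 0 fun x => ?_
  obtain ⟨y, hy⟩ := Abelian.Ext.contravariant_sequence_exact₂ h.shortExact _ x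
    ((hA n).allEq _ _)
  obtain rfl : y = 0 := (hD n).allEq _ _
  exact hy.symm.trans (Abelian.Ext.comp_zero ..)

lemma kernel (h : LinearMap.IsShortExact f g) (hB : ExtVanish R B N) (hD : ExtVanish R D N) :
    ExtVanish R A N := fun n => by
  refine subsingleton_of_forall_eq 0 fun x => ?_
  obtain ⟨y, hy⟩ := Abelian.Ext.contravariant_sequence_exact₁ h.shortExact _ x (add_comm 1 (n + 1))
    ((hD (n + 1)).allEq _ _)
  obtain rfl : y = 0 := (hB n).allEq _ _
  exact hy.symm.trans (Abelian.Ext.comp_zero ..)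

lemma subsingleton_cokernel (h : LinearMap.IsShortExact f g) (hB : ExtVanish R B N) {n : ℕ}
    (hA : Subsingleton (Abelian.Ext.{u} (ModuleCat.of R A) (ModuleCat.of R N) (n + 1))) :
    Subsingleton (Abelian.Ext.{u} (ModuleCat.of R D) (ModuleCat.of R N) (n + 1 + 1)) := by
  refine subsingleton_of_forall_eq 0 fun x => ?_
  obtain ⟨y, hy⟩ := Abelian.Ext.contravariant_sequence_exact₃ h.shortExact _ x
    ((hB (n + 1)).allEq _ _)
    (add_comm 1 (n + 1))
  obtain rfl : y = 0 := hA.allEq _ _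
  exact hy.symm.trans (Abelian.Ext.comp_zero ..)

lemma subsingleton_cokernel_of_lcomp_surjective (h : LinearMap.IsShortExact f g)
    (hB : ExtVanish R B N) (hs : Function.Surjective (f.lcomp R N)) :
    Subsingleton (Abelian.Ext.{u} (ModuleCat.of R D) (ModuleCat.of R N) 1) := by
  refine subsingleton_of_forall_eq 0 fun x => ?_
  obtain ⟨y, hy⟩ := Abelian.Ext.contravariant_sequence_exact₃ h.shortExact _ x
    ((hB 0).allEq _ _)
    (add_comm 1 0)
  obtain ⟨φ, rfl⟩ := (Abelian.Ext.mk₀_bijective _ _).2 y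
  obtain ⟨ψ, hψ⟩ := hs φ.hom
  obtain ⟨χ, rfl⟩ : ∃ χ : (ShortComplex.moduleCatMk f g h.exact.linearMap_comp_eq_zero).X₂ ⟶ _,
      (ShortComplex.moduleCatMk f g h.exact.linearMap_comp_eq_zero).f ≫ χ = φ :=
    ⟨ModuleCat.ofHom ψ, ModuleCat.hom_ext hψ⟩
  rw [← Abelian.Ext.mk₀_comp_mk₀] at hy
  exact hy.symm.trans (h.shortExact.extClass_comp_assoc _)

lemma lcomp_surjective (h : LinearMap.IsShortExact f g)
    (hD : Subsingleton (Abelian.Ext.{u} (ModuleCat.of R D) (ModuleCat.of R N) 1)) :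
    Function.Surjective (f.lcomp R N) := fun φ => by
  obtain ⟨y, hy⟩ := Abelian.Ext.contravariant_sequence_exact₁ h.shortExact _
    (Abelian.Ext.mk₀ (ModuleCat.ofHom φ)) (add_comm 1 0)
    (hD.allEq _ _)
  obtain ⟨ψ, rfl⟩ := (Abelian.Ext.mk₀_bijective _ _).2 y
  rw [Abelian.Ext.mk₀_comp_mk₀] at hy
  exact ⟨ψ.hom, congrArg ModuleCat.Hom.hom ((Abelian.Ext.mk₀_bijective _ _).1 hy)⟩

lemma of_retract (hB : ExtVanish R B N) (i : A →ₗ[R] B) (r : B →ₗ[R] A)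
    (hr : r.comp i = LinearMap.id) : ExtVanish R A N := fun n => by
  have := hB n
  refine subsingleton_of_forall_eq 0 fun x => ?_
  have h1 : (Abelian.Ext.mk₀ (ModuleCat.ofHom r)).comp x (zero_add _) = 0 := Subsingleton.elim _ _
  have h2 : ModuleCat.ofHom i ≫ ModuleCat.ofHom r = 𝟙 _ := by ext1; exact hr
  rw [← Abelian.Ext.mk₀_id_comp x, ← h2, ← Abelian.Ext.mk₀_comp_mk₀_assoc, h1,
    Abelian.Ext.comp_zero]

lemma of_equiv (e : A ≃ₗ[R] B) (hB : ExtVanish R B N) : ExtVanish R A N :=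
  hB.of_retract e.toLinearMap e.symm.toLinearMap (by ext; simp)

lemma of_equiv_right {N' : Type u} [AddCommGroup N'] [Module R N'] (e : N ≃ₗ[R] N')
    (hB : ExtVanish R B N) : ExtVanish R B N' := fun n => by
  have := hB n
  refine subsingleton_of_forall_eq 0 fun x => ?_
  have h1 : x.comp (Abelian.Ext.mk₀ (ModuleCat.ofHom e.symm.toLinearMap)) (add_zero _) = 0 :=
    Subsingleton.elim _ _
  have h2 : ModuleCat.ofHom e.symm.toLinearMap ≫ ModuleCat.ofHom e.toLinearMap = 𝟙 _ := by
    ext1; ext; simp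
  rw [← Abelian.Ext.comp_mk₀_id x, ← h2, ← Abelian.Ext.mk₀_comp_mk₀,
    ← Abelian.Ext.comp_assoc_of_second_deg_zero, h1, Abelian.Ext.zero_comp]

lemma of_projective [Module.Projective R A] : ExtVanish R A N := fun n => by
  have : Projective (ModuleCat.of R A) := (IsProjective.iff_projective A).1 inferInstance
  exact Abelian.Ext.subsingleton_of_projective _ _ _

lemma of_extZero (M N : ModuleCat.{u} R)
    (h : ∀ i : ℕ, 1 ≤ i → Subsingleton (((Ext R (ModuleCat.{u} R) i).obj (Opposite.op M)).obj N)) :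
    ExtVanish R M N := fun n => by
  let P := projectiveResolution M
  have := h (n + 1) (by omega)
  have hz : Limits.IsZero ((P.complex.linearYonedaObj R N).homology (n + 1)) :=
    (ModuleCat.isZero_of_subsingleton _).of_iso (P.isoExt (n + 1) N).symm
  have hex := (HomologicalComplex.exactAt_iff_isZero_homology _ _).2 hz
  rw [HomologicalComplex.exactAt_iff' _ n (n + 1) (n + 2) (by simp) (by simp),
    ShortComplex.moduleCat_exact_iff] at hex
  refine subsingleton_of_forall_eq 0 fun x => ?_
  obtain ⟨φ, hφ, rfl⟩ := P.extMk_surjective x (n + 2) rfl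
  rw [P.extMk_eq_zero_iff φ (n + 2) rfl hφ n rfl]
  exact hex φ hφ

end ExtVanish
end ExtVanish

/-- The higher extension groups of `A` into the character modules of all the modules
`Hom(C, I)` with `I` injective vanish. -/
def DualExtVanish (R : Type u) [CommRing R] (C A : Type u) [AddCommGroup C] [Module R C]
    [AddCommGroup A] [Module R A] : Prop :=
  ∀ (I : Type u) [AddCommGroup I] [Module R I] [Module.Injective R I],
    ExtVanish R A (CharacterModule (C →ₗ[R] I))

section Acyclicity

variable {R : Type u} [CommRing R] {A B D J : Type u} [AddCommGroup A]
    [Module R A] [AddCommGroup B] [Module R B] [AddCommGroup D] [Module R D]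
    [AddCommGroup J] [Module R J] {f : A →ₗ[R] B} {g : B →ₗ[R] D}

lemma LinearMap.IsShortExact.lTensor (h : LinearMap.IsShortExact f g) (F : Type u)
    [AddCommGroup F] [Module R F] [Module.Flat R F] :
    LinearMap.IsShortExact (f.lTensor F) (g.lTensor F) :=
  ⟨Module.Flat.lTensor_preserves_injective_linearMap f h.injective,
    LinearMap.lTensor_surjective F h.surjective, lTensor_exact F h.exact h.surjective⟩

lemma LinearMap.IsShortExact.flat_left [Module.Flat R B] [Module.Flat R D]
    (h : LinearMap.IsShortExact f g) : Module.Flat R A :=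
  Module.Flat.of_exact_of_flat h.exact h.injective h.surjective

lemma rTensor_lTensor_injective (F : Type u) [AddCommGroup F] [Module R F] [Module.Flat R F]
    (hf : Function.Injective (f.rTensor J)) :
    Function.Injective ((f.lTensor F).rTensor J) := by
  have : (TensorProduct.assoc R F B J).toLinearMap ∘ₗ (f.lTensor F).rTensor J =
      (f.rTensor J).lTensor F ∘ₗ (TensorProduct.assoc R F A J).toLinearMap := by
    ext; simp
  refine Function.Injective.of_comp (f := TensorProduct.assoc R F B J) ?_
  have h2 := (Module.Flat.lTensor_preserves_injective_linearMap (M := F) _ hf).comp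
    (TensorProduct.assoc R F A J).injective
  convert h2 using 1
  exact congrArg DFunLike.coe this

variable (R) in
lemma Module.exists_free_cover (A : Type u) [AddCommGroup A] [Module R A] :
    ∃ (P : Type u) (_ : AddCommGroup P) (_ : Module R P) (_ : Module.Free R P) (p : P →ₗ[R] A),
      Function.Surjective p :=
  ⟨A →₀ R, inferInstance, inferInstance, inferInstance, _,
    Finsupp.linearCombination_id_surjective R A⟩

lemma ExtVanish.of_flat (F : Type u) [AddCommGroup F] [Module R F] [Module.Flat R F] :
    ExtVanish R F (CharacterModule J) := fun n => by
  induction n generalizing F with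
  | zero =>
    obtain ⟨P, _, _, _, p, hp⟩ := Module.exists_free_cover R F
    have h := LinearMap.IsShortExact.of_ker hp
    exact ExtVanish.subsingleton_cokernel_of_lcomp_surjective h .of_projective
      (rTensor_injective_iff_lcomp_surjective.1
        (Module.Flat.rTensor_injective_of_exact h.exact h.injective hp J))
  | succ n ih =>
    obtain ⟨P, _, _, _, p, hp⟩ := Module.exists_free_cover R F
    have h := LinearMap.IsShortExact.of_ker hp
    have := h.flat_left
    exact ExtVanish.subsingleton_cokernel h .of_projective (ih _)

lemma DualExtVanish.tensor [IsNoetherianRing R] (F C : Type u) [AddCommGroup F] [Module R F]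
    [Module.Flat R F] [AddCommGroup C] [Module R C] [Module.Finite R A]
    (hA : ExtVanish R A C) : DualExtVanish R C (F ⊗[R] A) := fun I _ _ _ n => by
  induction n generalizing A with
  | zero =>
    obtain ⟨m, p, hp⟩ := Module.Finite.exists_fin' R A
    have h := LinearMap.IsShortExact.of_ker hp
    exact ExtVanish.subsingleton_cokernel_of_lcomp_surjective (h.lTensor F) (.of_flat _)
      (rTensor_injective_iff_lcomp_surjective.1 (rTensor_lTensor_injective F
        (rTensor_hom_injective_of_lcomp_surjective (ExtVanish.lcomp_surjective h (hA 0)))))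
  | succ n ih =>
    obtain ⟨m, p, hp⟩ := Module.Finite.exists_fin' R A
    have h := LinearMap.IsShortExact.of_ker hp
    exact ExtVanish.subsingleton_cokernel (h.lTensor F) (.of_flat _)
      (ih (ExtVanish.kernel h .of_projective hA))

namespace LinearMap

lemma exists_comp_eq_of_surjective {X Y E : Type u} [AddCommGroup X] [Module R X]
    [AddCommGroup Y] [Module R Y] [AddCommGroup E] [Module R E] (u : X →ₗ[R] Y) (v : X →ₗ[R] E)
    (hu : Function.Surjective u) (hle : LinearMap.ker u ≤ LinearMap.ker v) :
    ∃ w : Y →ₗ[R] E, ∀ x, w (u x) = v x := by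
  refine ⟨((LinearMap.ker u).liftQ v hle).comp
    (u.quotKerEquivOfSurjective hu).symm.toLinearMap, fun x => ?_⟩
  have : (u.quotKerEquivOfSurjective hu).symm (u x) = Submodule.Quotient.mk x := by
    rw [LinearEquiv.symm_apply_eq]; rfl
  simp [this]

/-- Given `A ⊆ B ⊆ X`, the quotient `X / A` is an extension of `X / B` by `B / A`. -/
lemma IsShortExact.exists_quotient {X E : Type u} [AddCommGroup X] [Module R X]
    [AddCommGroup E] [Module R E] {f' : B →ₗ[R] X} {g' : X →ₗ[R] E}
    (h : IsShortExact f g) (h' : IsShortExact f' g') :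
    ∃ (i : D →ₗ[R] X ⧸ range (f'.comp f)) (p : (X ⧸ range (f'.comp f)) →ₗ[R] E),
      IsShortExact i p ∧ (∀ b, i (g b) = (range (f'.comp f)).mkQ (f' b)) := by
  obtain ⟨i, hi⟩ := exists_comp_eq_of_surjective g ((range (f'.comp f)).mkQ.comp f')
    h.surjective (by
      intro b hb
      obtain ⟨a, rfl⟩ := (h.exact b).1 hb
      simp only [mem_ker, comp_apply, Submodule.mkQ_apply, Submodule.Quotient.mk_eq_zero]
      exact ⟨a, rfl⟩)
  let p := (range (f'.comp f)).liftQ g' (by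
    rintro _ ⟨a, rfl⟩
    exact h'.exact.apply_apply_eq_zero _)
  refine ⟨i, p, ⟨?_, ?_, ?_⟩, hi⟩
  · rw [injective_iff_map_eq_zero]
    intro d hd
    obtain ⟨b, rfl⟩ := h.surjective d
    rw [hi, comp_apply, Submodule.mkQ_apply, Submodule.Quotient.mk_eq_zero] at hd
    obtain ⟨a, ha⟩ := hd
    rw [← h'.injective ha, h.exact.apply_apply_eq_zero]
  · intro e
    obtain ⟨x, rfl⟩ := h'.surjective e
    exact ⟨Submodule.Quotient.mk x, rfl⟩
  · intro q
    obtain ⟨x, rfl⟩ := Submodule.mkQ_surjective _ q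
    constructor
    · intro hx
      obtain ⟨b, rfl⟩ := (h'.exact x).1 hx
      exact ⟨g b, hi b⟩
    · rintro ⟨d, hd⟩
      obtain ⟨b, rfl⟩ := h.surjective d
      rw [← hd, hi]
      exact h'.exact.apply_apply_eq_zero b

/-- The horseshoe: if `φ : B → X` extends an embedding of `A`, then `B` embeds into the product
of `X` and any module into which `D` embeds, and the cokernel is an extension. -/
lemma IsShortExact.exists_horseshoe {X E X' E' : Type u} [AddCommGroup X] [Module R X]
    [AddCommGroup E] [Module R E] [AddCommGroup X'] [Module R X']
    [AddCommGroup E'] [Module R E'] {k : A →ₗ[R] X} {l : X →ₗ[R] E}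
    {k' : D →ₗ[R] X'} {l' : X' →ₗ[R] E'} (h : IsShortExact f g) (hk : IsShortExact k l)
    (hk' : IsShortExact k' l') (φ : B →ₗ[R] X) (hφ : ∀ a, φ (f a) = k a) :
    Function.Injective (φ.prod (k'.comp g)) ∧
    ∃ (i : E →ₗ[R] (X × X') ⧸ range (φ.prod (k'.comp g)))
      (p : ((X × X') ⧸ range (φ.prod (k'.comp g))) →ₗ[R] E'), IsShortExact i p := by
  constructor
  · rw [injective_iff_map_eq_zero]
    intro b hb
    obtain ⟨h1, h2⟩ := Prod.ext_iff.1 hb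
    obtain ⟨a, rfl⟩ := (h.exact b).1 (k'.map_eq_zero_iff hk'.injective |>.1 h2)
    have : k a = 0 := (hφ a).symm.trans h1
    rw [(k.map_eq_zero_iff hk.injective).1 this, map_zero]
  obtain ⟨i, hi⟩ := exists_comp_eq_of_surjective l
    ((range (φ.prod (k'.comp g))).mkQ.comp (LinearMap.inl R X X')) hk.surjective (by
      intro x hx
      obtain ⟨a, rfl⟩ := (hk.exact x).1 hx
      simp only [mem_ker, comp_apply, Submodule.mkQ_apply, Submodule.Quotient.mk_eq_zero]
      exact ⟨f a, Prod.ext (hφ a) (by simp [h.exact.apply_apply_eq_zero])⟩)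
  let p := (range (φ.prod (k'.comp g))).liftQ (l'.comp (LinearMap.snd R X X')) (by
    rintro _ ⟨b, rfl⟩
    exact hk'.exact.apply_apply_eq_zero _)
  refine ⟨i, p, ?_, ?_, ?_⟩
  · rw [injective_iff_map_eq_zero]
    intro e he
    obtain ⟨x, rfl⟩ := hk.surjective e
    rw [hi, comp_apply, Submodule.mkQ_apply, Submodule.Quotient.mk_eq_zero] at he
    obtain ⟨b, hb⟩ := he
    obtain ⟨h1, h2⟩ := Prod.ext_iff.1 hb
    obtain ⟨a, rfl⟩ := (h.exact b).1 (k'.map_eq_zero_iff hk'.injective |>.1 h2)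
    have : k a = x := (hφ a).symm.trans h1
    rw [← this, hk.exact.apply_apply_eq_zero]
  · intro e
    obtain ⟨x, rfl⟩ := hk'.surjective e
    exact ⟨Submodule.Quotient.mk (0, x), rfl⟩
  · intro q
    obtain ⟨⟨x, x'⟩, rfl⟩ := Submodule.mkQ_surjective _ q
    constructor
    · intro hx
      obtain ⟨d, rfl⟩ := (hk'.exact x').1 hx
      obtain ⟨b, rfl⟩ := h.surjective d
      refine ⟨l (x - φ b), ?_⟩
      rw [hi, comp_apply, ← sub_eq_zero, ← map_sub, Submodule.mkQ_apply,
        Submodule.Quotient.mk_eq_zero]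
      exact ⟨-b, by simp⟩
    · rintro ⟨e, he⟩
      obtain ⟨y, rfl⟩ := hk.surjective e
      rw [← he, hi]
      exact map_zero l'

end LinearMap

lemma ExtVanish.prod_right {N N' : Type u} [AddCommGroup N] [Module R N] [AddCommGroup N']
    [Module R N'] (h : ExtVanish R A N) (h' : ExtVanish R A N') :
    ExtVanish R A (N × N') := fun n => by
  have := h n
  have := h' n
  refine subsingleton_of_forall_eq 0 fun x => ?_
  let a := ModuleCat.ofHom (LinearMap.fst R N N')
  let b := ModuleCat.ofHom (LinearMap.snd R N N')
  have h1 : x.comp (Abelian.Ext.mk₀ a) (add_zero _) = 0 := Subsingleton.elim _ _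
  have h2 : x.comp (Abelian.Ext.mk₀ b) (add_zero _) = 0 := Subsingleton.elim _ _
  have h3 : a ≫ ModuleCat.ofHom (LinearMap.inl R N N') +
      b ≫ ModuleCat.ofHom (LinearMap.inr R N N') = 𝟙 _ := by
    ext1; exact LinearMap.ext fun z => Prod.ext (add_zero z.1) (zero_add z.2)
  rw [← Abelian.Ext.comp_mk₀_id x, ← h3, Abelian.Ext.mk₀_add, Abelian.Ext.comp_add,
    ← Abelian.Ext.mk₀_comp_mk₀, ← Abelian.Ext.mk₀_comp_mk₀,
    ← Abelian.Ext.comp_assoc_of_second_deg_zero, ← Abelian.Ext.comp_assoc_of_second_deg_zero,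
    h1, h2, Abelian.Ext.zero_comp, Abelian.Ext.zero_comp, add_zero]

namespace DualExtVanish

variable {C : Type u} [AddCommGroup C] [Module R C]

lemma kernel (h : LinearMap.IsShortExact f g) (hB : DualExtVanish R C B)
    (hD : DualExtVanish R C D) : DualExtVanish R C A := fun I _ _ _ => (hB I).kernel h (hD I)

lemma extension (h : LinearMap.IsShortExact f g) (hA : DualExtVanish R C A)
    (hD : DualExtVanish R C D) : DualExtVanish R C B := fun I _ _ _ => (hA I).extension h (hD I)

lemma of_retract (hB : DualExtVanish R C B) (i : A →ₗ[R] B) (r : B →ₗ[R] A)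
    (hr : r.comp i = LinearMap.id) : DualExtVanish R C A := fun I _ _ _ =>
  (hB I).of_retract i r hr

lemma of_equiv (e : A ≃ₗ[R] B) (hB : DualExtVanish R C B) : DualExtVanish R C A :=
  fun I _ _ _ => (hB I).of_equiv e

lemma of_flat [Module.Flat R A] : DualExtVanish R C A := fun _ _ _ _ => .of_flat A

lemma rTensor_injective (h : LinearMap.IsShortExact f g) (hD : DualExtVanish R C D)
    {I : Type u} [AddCommGroup I] [Module R I] [Module.Injective R I] (e : J ≃ₗ[R] (C →ₗ[R] I)) :
    Function.Injective (f.rTensor J) := by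
  have h1 : Function.Injective (f.rTensor (C →ₗ[R] I)) :=
    rTensor_injective_iff_lcomp_surjective.2 (ExtVanish.lcomp_surjective h (hD I 0))
  refine Function.Injective.of_comp (f := e.lTensor B) ?_
  convert h1.comp (e.lTensor A).injective using 1
  refine congrArg DFunLike.coe
    (?_ : (e.lTensor B).toLinearMap ∘ₗ f.rTensor J = f.rTensor _ ∘ₗ (e.lTensor A).toLinearMap)
  ext; simp

end DualExtVanish

lemma Module.Flat.prod [Module.Flat R A] [Module.Flat R B] : Module.Flat R (A × B) := by
  rw [Module.Flat.iff_rTensor_injective']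
  intro I
  refine Function.Injective.of_comp (f := TensorProduct.prodRight R R R A B) ?_
  have hA := Module.Flat.iff_rTensor_injective'.1 ‹Module.Flat R A› I
  have hB := Module.Flat.iff_rTensor_injective'.1 ‹Module.Flat R B› I
  convert (Prod.map_injective.2 ⟨hA, hB⟩).comp (TensorProduct.prodRight R R I A B).injective using 1
  refine congrArg DFunLike.coe (?_ : (TensorProduct.prodRight R R R A B).toLinearMap ∘ₗ
    I.subtype.rTensor (A × B) = ((I.subtype.rTensor A).prodMap (I.subtype.rTensor B)) ∘ₗ
      (TensorProduct.prodRight R R I A B).toLinearMap)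
  ext <;> simp

end Acyclicity

section CFlat

variable {R : Type u} [CommRing R] {C : ModuleCat.{u} R}

lemma IsCFlat.of_equiv {Y Y' : ModuleCat.{u} R} (hY : IsCFlat R C Y) (e : Y' ≃ₗ[R] Y) :
    IsCFlat R C Y' :=
  let ⟨F, hF, ⟨e'⟩⟩ := hY
  ⟨F, hF, ⟨e ≪≫ₗ e'⟩⟩

lemma isCFlat_tensor (F : Type u) [AddCommGroup F] [Module R F] [Module.Flat R F] :
    IsCFlat R C (ModuleCat.of R (F ⊗[R] C)) :=
  ⟨ModuleCat.of R F, inferInstanceAs (Module.Flat R F), ⟨LinearEquiv.refl R _⟩⟩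

lemma IsCFlat.prod {Y Y' : ModuleCat.{u} R} (hY : IsCFlat R C Y) (hY' : IsCFlat R C Y') :
    IsCFlat R C (ModuleCat.of R (Y × Y')) := by
  obtain ⟨F, hF, ⟨e⟩⟩ := hY
  obtain ⟨F', hF', ⟨e'⟩⟩ := hY'
  have : Module.Flat R (F × F') := .prod
  exact (isCFlat_tensor (C := C) (F × F')).of_equiv
    ((e.prodCongr e') ≪≫ₗ (TensorProduct.prodLeft R R F F' C).symm)

lemma isCFlat_of_subsingleton (Y : ModuleCat.{u} R) [Subsingleton Y] : IsCFlat R C Y := by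
  have : Subsingleton (PUnit.{u + 1} ⊗[R] C) := inferInstance
  exact (isCFlat_tensor (C := C) PUnit.{u + 1}).of_equiv
    ⟨0, 0, fun _ => Subsingleton.elim _ _, fun _ => Subsingleton.elim _ _⟩

variable [IsNoetherianRing R]

lemma IsSemidualizing.dualExtVanish (hC : IsSemidualizing R C) {Y : ModuleCat.{u} R}
    (hY : IsCFlat R C Y) : DualExtVanish R C Y := by
  obtain ⟨F, hF, ⟨e⟩⟩ := hY
  have := hC.1
  exact (DualExtVanish.tensor F C (ExtVanish.of_extZero C C hC.2.2)).of_equiv e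

/-- A `C`-flat module embeds, with `C`-flat cokernel, into a `C`-flat module that is
right `Ext`-orthogonal to all modules satisfying `DualExtVanish`. -/
lemma IsSemidualizing.exists_cflat_hull (hC : IsSemidualizing R C) {Y : ModuleCat.{u} R}
    (hY : IsCFlat R C Y) :
    ∃ (D E : ModuleCat.{u} R) (f : Y →ₗ[R] D) (g : D →ₗ[R] E), IsCFlat R C D ∧ IsCFlat R C E ∧
      LinearMap.IsShortExact f g ∧
      ∀ N : ModuleCat.{u} R, DualExtVanish R C N → ExtVanish R N D := by
  obtain ⟨F, hF, ⟨e⟩⟩ := hY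
  have := hC.1
  obtain ⟨h1, h2⟩ := Module.Flat.quotient_biduality (R := R) (A := F)
  have hi := Module.Flat.iff_characterModule_injective.1 hF
  have hses := LinearMap.IsShortExact.of_mkQ (CharacterModule.biduality_injective (R := R) (A := F))
  refine ⟨_, _, (CharacterModule.biduality R F).rTensor C ∘ₗ e.toLinearMap,
    (LinearMap.range (CharacterModule.biduality R F)).mkQ.rTensor C,
    isCFlat_tensor (CharacterModule (CharacterModule F)), isCFlat_tensor _, ⟨?_, ?_, ?_⟩, ?_⟩
  · exact (Module.Flat.rTensor_injective_of_exact hses.exact hses.injective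
      hses.surjective C).comp e.injective
  · exact LinearMap.rTensor_surjective C hses.surjective
  · exact (e.toEquiv.surjective.comp_exact_iff_exact).2 (rTensor_exact C hses.exact hses.surjective)
  · intro N hN
    obtain ⟨e'⟩ := CharacterModule.nonempty_tensor_equiv (R := R) (A := C) (B := CharacterModule F)
    exact (hN (CharacterModule F)).of_equiv_right e'

end CFlat

section GCFlat

variable {R : Type u} [CommRing R] {C : ModuleCat.{u} R}

/-- A complete resolution can be assembled from a doubly infinite sequence of
short exact sequences `0 → L (i + 1) → X (i + 1) → L i → 0`. -/
lemma isGCFlat_of_isShortExact (L X : ℤ → ModuleCat.{u} R) (j : ∀ i, L i →ₗ[R] X i)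
    (p : ∀ i, X (i + 1) →ₗ[R] L i) (h : ∀ i, LinearMap.IsShortExact (j (i + 1)) (p i))
    (hL : ∀ i, DualExtVanish R C (L i)) (hflat : ∀ i, 0 ≤ i → Module.Flat R (X i))
    (hcflat : ∀ i < 0, IsCFlat R C (X i)) : IsGCFlat R C (L (-1)) := by
  have hj (i : ℤ) : Function.Injective (j i) := by
    obtain ⟨k, rfl⟩ : ∃ k, k + 1 = i := ⟨i - 1, by ring⟩
    exact (h k).injective
  let Z : ZComplex R :=
    { X := X
      d := fun i => (j i).comp (p i)
      d_comp_d := fun i => LinearMap.ext fun x =>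
        (congrArg (j i) ((h i).exact.apply_apply_eq_zero (p (i + 1) x))).trans (map_zero _) }
  refine ⟨Z, fun i => ?_, hflat, hcflat, ?_, ?_⟩
  · have := (h (i + 1)).surjective.comp_exact_iff_exact.2 (h i).exact
    exact (hj i).comp_exact_iff_exact.2 this
  · rintro J ⟨I, hI, ⟨e⟩⟩ i
    have hJ : Function.Injective ((j i).rTensor J) := by
      obtain ⟨k, rfl⟩ : ∃ k, k + 1 = i := ⟨i - 1, by ring⟩
      exact (hL k).rTensor_injective (h k) e
    have h1 := rTensor_exact J (h i).exact (h i).surjective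
    have h2 := (LinearMap.rTensor_surjective J (h (i + 1)).surjective).comp_exact_iff_exact.2 h1
    have h3 := hJ.comp_exact_iff_exact.2 h2
    rw [← LinearMap.rTensor_comp, ← LinearMap.rTensor_comp] at h3
    exact h3
  · have hr : LinearMap.ker (p (-1)) = LinearMap.range (Z.d 0) := by
      rw [LinearMap.exact_iff.1 (h (-1)).exact]
      exact (LinearMap.range_comp_of_range_eq_top _
        (LinearMap.range_eq_top.2 (h 0).surjective)).symm
    exact ⟨((Submodule.quotEquivOfEq _ _ hr.symm) ≪≫ₗ
      (p (-1)).quotKerEquivOfSurjective (h (-1)).surjective).symm⟩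

/-- The coinductive description of `G_C`-flatness: a class all of whose members satisfy
`DualExtVanish` and embed into a `C`-flat module with cokernel in the class. -/
def IsCFlatCosyzygyClosed (R : Type u) [CommRing R] (C : ModuleCat.{u} R)
    (P : ModuleCat.{u} R → Prop) : Prop :=
  ∀ N, P N → DualExtVanish R C N ∧ ∃ (Y L : ModuleCat.{u} R) (f : N →ₗ[R] Y) (g : Y →ₗ[R] L),
    IsCFlat R C Y ∧ LinearMap.IsShortExact f g ∧ P L

lemma exists_seq_of_forall_exists {α : Type*} {P : α → Prop} {r : α → α → Prop}
    (h : ∀ a, P a → ∃ b, r a b ∧ P b) (a : α) (ha : P a) :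
    ∃ s : ℕ → α, s 0 = a ∧ ∀ n, P (s n) ∧ r (s n) (s (n + 1)) := by
  choose! t ht using h
  have hP (n : ℕ) : P (t^[n] a) := by
    induction n with
    | zero => exact ha
    | succ n ih => rw [Function.iterate_succ_apply']; exact (ht _ ih).2
  refine ⟨fun n => t^[n] a, rfl, fun n => ⟨hP n, ?_⟩⟩
  change r (t^[n] a) (t^[n + 1] a)
  rw [Function.iterate_succ_apply']
  exact (ht _ (hP n)).1

lemma IsCFlatCosyzygyClosed.isGCFlat {P : ModuleCat.{u} R → Prop}
    (hP : IsCFlatCosyzygyClosed R C P) {M : ModuleCat.{u} R} (hM : P M) : IsGCFlat R C M := by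
  obtain ⟨s, hs0, hs⟩ := exists_seq_of_forall_exists (P := P)
    (r := fun N L => ∃ (Y : ModuleCat.{u} R) (f : N →ₗ[R] Y) (g : Y →ₗ[R] L),
      IsCFlat R C Y ∧ LinearMap.IsShortExact f g)
    (fun N hN => by
      obtain ⟨-, Y, L, f, g, h1, h2, h3⟩ := hP N hN
      exact ⟨L, ⟨Y, f, g, h1, h2⟩, h3⟩) M hM
  obtain ⟨t, ht0, ht⟩ := exists_seq_of_forall_exists (P := fun N : ModuleCat.{u} R =>
      DualExtVanish R C N)
    (r := fun N L => ∃ (Y : ModuleCat.{u} R) (f : L →ₗ[R] Y) (g : Y →ₗ[R] N),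
      Module.Flat R Y ∧ LinearMap.IsShortExact f g)
    (fun N hN => by
      obtain ⟨Q, _, _, _, q, hq⟩ := Module.exists_free_cover R N
      have h := LinearMap.IsShortExact.of_ker hq
      exact ⟨ModuleCat.of R (LinearMap.ker q), ⟨ModuleCat.of R Q, _, q,
        inferInstanceAs (Module.Flat R Q), h⟩, DualExtVanish.kernel h .of_flat hN⟩) M (hP M hM).1
  let L : ℤ → ModuleCat.{u} R
    | Int.ofNat n => t (n + 1)
    | Int.negSucc n => s n
  have hL (i : ℤ) : DualExtVanish R C (L i) := by
    match i with
    | Int.ofNat n => exact (ht (n + 1)).1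
    | Int.negSucc n => exact (hP _ (hs n).1).1
  have step (i k : ℤ) (hk : k + 1 = i) : ∃ (Y : ModuleCat.{u} R) (f : L i →ₗ[R] Y)
      (g : Y →ₗ[R] L k), (0 ≤ i → Module.Flat R Y) ∧ (i < 0 → IsCFlat R C Y) ∧
        LinearMap.IsShortExact f g := by
    match i, k, hk with
    | Int.ofNat n, Int.ofNat m, hk =>
      obtain rfl : n = m + 1 := by simp only [Int.ofNat_eq_natCast] at hk; omega
      obtain ⟨Y, f, g, h1, h2⟩ := (ht (m + 1)).2
      exact ⟨Y, f, g, fun _ => h1,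
        fun h => absurd h (by simp only [Int.ofNat_eq_natCast]; omega), h2⟩
    | Int.ofNat n, Int.negSucc m, hk =>
      obtain ⟨rfl, rfl⟩ : n = 0 ∧ m = 0 := by
        simp only [Int.ofNat_eq_natCast] at hk; omega
      obtain ⟨Y, f, g, h1, h2⟩ := (ht 0).2
      have h0 : L (Int.negSucc 0) = t 0 := hs0.trans ht0.symm
      rw [h0]
      exact ⟨Y, f, g, fun _ => h1, fun h => absurd h (by simp), h2⟩
    | Int.negSucc n, Int.ofNat m, hk => simp only [Int.ofNat_eq_natCast] at hk; omega
    | Int.negSucc n, Int.negSucc m, hk =>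
      obtain rfl : m = n + 1 := by omega
      obtain ⟨Y, f, g, h1, h2⟩ := (hs n).2
      exact ⟨Y, f, g, fun h => absurd h (by omega), fun _ => h1, h2⟩
  choose X j p hflat hcflat hses using fun i => step i (i - 1) (by ring)
  have hp (i : ℤ) : ∃ q : X (i + 1) →ₗ[R] L i, LinearMap.IsShortExact (j (i + 1)) q := by
    have : ∃ q : X (i + 1) →ₗ[R] L (i + 1 - 1), LinearMap.IsShortExact (j (i + 1)) q :=
      ⟨p (i + 1), hses (i + 1)⟩
    rwa [add_sub_cancel_right] at this
  choose q hq using hp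
  have := isGCFlat_of_isShortExact L X j q hq hL hflat hcflat
  exact hs0 ▸ this

variable [IsNoetherianRing R]

lemma IsSemidualizing.isCFlatCosyzygyClosed_range (hC : IsSemidualizing R C) {Z : ZComplex R}
    (hex : Z.IsExact) (hflat : ∀ i, 0 ≤ i → Module.Flat R (Z.X i))
    (hcflat : ∀ i < 0, IsCFlat R C (Z.X i))
    (hten : ∀ J : ModuleCat.{u} R, IsCInjective R C J → Z.TensorExact J) :
    IsCFlatCosyzygyClosed R C fun N => ∃ i < 0, Nonempty (N ≃ₗ[R] LinearMap.range (Z.d i)) := by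
  have h (i : ℤ) : LinearMap.IsShortExact (LinearMap.range (Z.d (i + 1))).subtype
      (Z.d i).rangeRestrict :=
    ⟨Submodule.subtype_injective _, LinearMap.surjective_rangeRestrict _, by
      rw [LinearMap.exact_iff, LinearMap.ker_rangeRestrict, Submodule.range_subtype]
      exact LinearMap.exact_iff.1 (hex i)⟩
  have hX (i : ℤ) : DualExtVanish R C (Z.X i) := by
    rcases lt_or_ge i 0 with hi | hi
    · exact hC.dualExtVanish (hcflat i hi)
    · have := hflat i hi
      exact .of_flat
  have hL (i : ℤ) : DualExtVanish R C (LinearMap.range (Z.d i)) := fun I _ _ _ n => by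
    induction n generalizing i with
    | zero =>
      refine ExtVanish.subsingleton_cokernel_of_lcomp_surjective (h i) (hX _ I)
        (rTensor_injective_iff_lcomp_surjective.1 ?_)
      have hT := hten (ModuleCat.of R (C →ₗ[R] I)) ⟨ModuleCat.of R I, ‹_›, ⟨LinearEquiv.refl R _⟩⟩
        (i + 1)
      rw [injective_iff_map_eq_zero]
      intro x hx
      obtain ⟨y, rfl⟩ := LinearMap.rTensor_surjective (C →ₗ[R] I)
        (Z.d (i + 1)).surjective_rangeRestrict x
      rw [← LinearMap.comp_apply, ← LinearMap.rTensor_comp] at hx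
      obtain ⟨z, rfl⟩ := (hT y).1 hx
      have h0 : (Z.d (i + 1)).rangeRestrict.comp (Z.d (i + 1 + 1)) = 0 := by
        ext w
        exact LinearMap.congr_fun (Z.d_comp_d (i + 1)) w
      refine (LinearMap.rTensor_comp_apply _ _ _ _).symm.trans ?_
      rw [h0, LinearMap.rTensor_zero, LinearMap.zero_apply]
    | succ n ih => exact ExtVanish.subsingleton_cokernel (h i) (hX _ I) (ih (i + 1))
  rintro N ⟨i, hi, ⟨e⟩⟩
  refine ⟨(hL i).of_equiv e, ?_⟩
  obtain ⟨k, rfl⟩ : ∃ k, k + 1 = i := ⟨i - 1, by ring⟩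
  refine ⟨Z.X (k + 1), ModuleCat.of R (LinearMap.range (Z.d k)),
    (LinearMap.range (Z.d (k + 1))).subtype ∘ₗ e.toLinearMap, (Z.d k).rangeRestrict,
    hcflat _ hi, ⟨(h k).injective.comp e.injective, (h k).surjective,
      e.surjective.comp_exact_iff_exact.2 (h k).exact⟩, k, by omega, ⟨LinearEquiv.refl R _⟩⟩

lemma IsSemidualizing.isGCFlat_iff (hC : IsSemidualizing R C) {M : ModuleCat.{u} R} :
    IsGCFlat R C M ↔ ∃ P, IsCFlatCosyzygyClosed R C P ∧ P M := by
  refine ⟨?_, fun ⟨P, hP, hM⟩ => hP.isGCFlat hM⟩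
  rintro ⟨Z, hex, hflat, hcflat, hten, ⟨e⟩⟩
  have hquot (i k : ℤ) (hk : k + 1 = i) :
      Nonempty ((Z.X i ⧸ LinearMap.range (Z.d i)) ≃ₗ[R] LinearMap.range (Z.d k)) := by
    subst hk
    exact ⟨Submodule.quotEquivOfEq _ _ (LinearMap.exact_iff.1 (hex k)).symm ≪≫ₗ
      (Z.d k).quotKerEquivRange⟩
  obtain ⟨e'⟩ := hquot 0 (-1) (by norm_num)
  exact ⟨_, hC.isCFlatCosyzygyClosed_range hex hflat hcflat hten, -1, by norm_num, ⟨e ≪≫ₗ e'⟩⟩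

lemma IsSemidualizing.isCFlatCosyzygyClosed_isGCFlat (hC : IsSemidualizing R C) :
    IsCFlatCosyzygyClosed R C (IsGCFlat R C) := fun N hN => by
  obtain ⟨P, hP, hPN⟩ := hC.isGCFlat_iff.1 hN
  obtain ⟨h1, Y, L, f, g, h2, h3, h4⟩ := hP N hPN
  exact ⟨h1, Y, L, f, g, h2, h3, hP.isGCFlat h4⟩

lemma IsSemidualizing.isGCFlat_of_isCFlat (hC : IsSemidualizing R C) {Y : ModuleCat.{u} R}
    (hY : IsCFlat R C Y) : IsGCFlat R C Y := by
  refine IsCFlatCosyzygyClosed.isGCFlat (P := IsCFlat R C) (fun N hN => ?_) hY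
  refine ⟨hC.dualExtVanish hN, N, ModuleCat.of R PUnit.{u + 1}, LinearMap.id, 0, hN,
    ⟨Function.injective_id, fun x => ⟨0, Subsingleton.elim _ _⟩, fun x => ?_⟩, ?_⟩
  · simp
  · have : Subsingleton (ModuleCat.of R PUnit.{u + 1}) := inferInstanceAs (Subsingleton PUnit)
    exact isCFlat_of_subsingleton _

/-- The closure of the class of `G_C`-flat modules under extensions. -/
inductive GCFlatExtension (R : Type u) [CommRing R] (C : ModuleCat.{u} R) : ModuleCat.{u} R → Prop
  | of_isGCFlat {M : ModuleCat.{u} R} (h : IsGCFlat R C M) : GCFlatExtension R C M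
  | extension {M' M M'' : ModuleCat.{u} R} (f : M' →ₗ[R] M) (g : M →ₗ[R] M'')
    (h : LinearMap.IsShortExact f g) (h' : GCFlatExtension R C M')
    (h'' : GCFlatExtension R C M'') : GCFlatExtension R C M

lemma GCFlatExtension.exists_cflat_hull (hC : IsSemidualizing R C) {M : ModuleCat.{u} R}
    (hM : GCFlatExtension R C M) :
    DualExtVanish R C M ∧ ∃ (D L : ModuleCat.{u} R) (f : M →ₗ[R] D) (g : D →ₗ[R] L),
      IsCFlat R C D ∧ (∀ N : ModuleCat.{u} R, DualExtVanish R C N → ExtVanish R N D) ∧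
      LinearMap.IsShortExact f g ∧ GCFlatExtension R C L := by
  induction hM with
  | @of_isGCFlat M h =>
    obtain ⟨hW, Y, L, f, g, hY, hses, hL⟩ := hC.isCFlatCosyzygyClosed_isGCFlat M h
    obtain ⟨D, E, f', g', hD, hE, hses', hort⟩ := hC.exists_cflat_hull hY
    obtain ⟨i, p, hip, -⟩ := hses.exists_quotient hses'
    exact ⟨hW, D, ModuleCat.of R _, f'.comp f, _, hD, hort,
      .of_mkQ (hses'.injective.comp hses.injective),
      .extension (M' := L) (M'' := E) i p hip (.of_isGCFlat hL)
        (.of_isGCFlat (hC.isGCFlat_of_isCFlat hE))⟩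
  | @extension M' M M'' f g h _ _ ih' ih'' =>
    obtain ⟨hW', D', L', k', l', hD', hort', hses', hL'⟩ := ih'
    obtain ⟨hW'', D'', L'', k'', l'', hD'', hort'', hses'', hL''⟩ := ih''
    obtain ⟨φ, hφ⟩ := ExtVanish.lcomp_surjective h (hort' M'' hW'' 0) k'
    obtain ⟨hinj, i, p, hip⟩ := h.exists_horseshoe hses' hses'' φ (LinearMap.congr_fun hφ)
    exact ⟨hW'.extension h hW'', ModuleCat.of R (D' × D''), ModuleCat.of R _, _, _,
      hD'.prod hD'', fun N hN => (hort' N hN).prod_right (hort'' N hN), .of_mkQ hinj,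
      .extension (M' := L') (M'' := L'') i p hip hL' hL''⟩

lemma IsSemidualizing.isGCFlat_extension (hC : IsSemidualizing R C) {M' M M'' : ModuleCat.{u} R}
    {f : M' →ₗ[R] M} {g : M →ₗ[R] M''} (h : LinearMap.IsShortExact f g)
    (h' : IsGCFlat R C M') (h'' : IsGCFlat R C M'') : IsGCFlat R C M := by
  refine IsCFlatCosyzygyClosed.isGCFlat (P := GCFlatExtension R C) (fun N hN => ?_)
    (.extension f g h (.of_isGCFlat h') (.of_isGCFlat h''))
  obtain ⟨hW, D, L, f, g, hD, -, hses, hL⟩ := hN.exists_cflat_hull hC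
  exact ⟨hW, D, L, f, g, hD, hses, hL⟩

lemma IsSemidualizing.isGCFlat_kernel (hC : IsSemidualizing R C) {M' M M'' : ModuleCat.{u} R}
    {f : M' →ₗ[R] M} {g : M →ₗ[R] M''} (h : LinearMap.IsShortExact f g)
    (hM : IsGCFlat R C M) (h'' : IsGCFlat R C M'') : IsGCFlat R C M' := by
  have hGF := hC.isCFlatCosyzygyClosed_isGCFlat
  obtain ⟨hW, Y, L, k, l, hY, hses, hL⟩ := hGF M hM
  obtain ⟨i, p, hip, -⟩ := h.exists_quotient hses
  have hQ : IsGCFlat R C (ModuleCat.of R (Y ⧸ LinearMap.range (k.comp f))) :=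
    hC.isGCFlat_extension (M' := M'') (M'' := L) hip h'' hL
  refine IsCFlatCosyzygyClosed.isGCFlat (P := fun N => N = M' ∨ IsGCFlat R C N) ?_ (.inl rfl)
  rintro N (rfl | hN)
  · exact ⟨hW.kernel h (hGF M'' h'').1, Y, ModuleCat.of R _, _, _, hY,
      .of_mkQ (hses.injective.comp h.injective), .inr hQ⟩
  · obtain ⟨h1, Y, L, f, g, h2, h3, h4⟩ := hGF N hN
    exact ⟨h1, Y, L, f, g, h2, h3, .inr h4⟩

lemma IsSemidualizing.isGCFlat_of_retract (hC : IsSemidualizing R C) {M N : ModuleCat.{u} R}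
    (hM : IsGCFlat R C M) (j : N →ₗ[R] M) (r : M →ₗ[R] N) (hr : r.comp j = LinearMap.id) :
    IsGCFlat R C N := by
  refine IsCFlatCosyzygyClosed.isGCFlat (P := fun N => ∃ (M : ModuleCat.{u} R) (j : N →ₗ[R] M)
    (r : M →ₗ[R] N), IsGCFlat R C M ∧ r.comp j = LinearMap.id) ?_ ⟨M, j, r, hM, hr⟩
  clear! M N
  rintro N ⟨M, j, r, hM, hr⟩
  have hr' (n : N) : r (j n) = n := LinearMap.congr_fun hr n
  obtain ⟨hW, Y, L, k, l, hY, hses, hL⟩ := hC.isCFlatCosyzygyClosed_isGCFlat M hM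
  have hj : LinearMap.IsShortExact j (LinearMap.range j).mkQ :=
    .of_mkQ (Function.LeftInverse.injective hr')
  obtain ⟨i, p, hip, hi⟩ := hj.exists_quotient hses
  refine ⟨hW.of_retract j r hr, Y, ModuleCat.of R _, _, _, hY,
    .of_mkQ (hses.injective.comp hj.injective),
    ModuleCat.of R (N × (Y ⧸ LinearMap.range (k.comp j))),
    LinearMap.inr R _ _, LinearMap.snd R _ _, ?_, LinearMap.snd_comp_inr _ _ _⟩
  refine hC.isGCFlat_extension (M' := M) (M'' := L)
    (f := r.prod (i.comp (LinearMap.range j).mkQ)) (g := p.comp (LinearMap.snd R _ _))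
    ⟨?_, ?_, ?_⟩ hM hL
  · rw [injective_iff_map_eq_zero]
    intro m hm
    obtain ⟨h1, h2⟩ := Prod.ext_iff.1 hm
    obtain ⟨n, rfl⟩ := (hj.exact m).1 (i.map_eq_zero_iff hip.injective |>.1 h2)
    have : n = 0 := (hr' n).symm.trans h1
    rw [this, map_zero]
  · exact hip.surjective.comp LinearMap.snd_surjective
  · rintro ⟨n, q⟩
    constructor
    · intro hq
      obtain ⟨x, rfl⟩ := (hip.exact q).1 hq
      obtain ⟨m, rfl⟩ := hj.surjective x
      refine ⟨m - j (r m) + j n, Prod.ext (by simp [hr']) ?_⟩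
      have (n : N) : (LinearMap.range j).mkQ (j n) = 0 := hj.exact.apply_apply_eq_zero n
      change i ((LinearMap.range j).mkQ (m - j (r m) + j n)) = _
      rw [map_add, map_sub, this, this, sub_zero, add_zero]
    · rintro ⟨m, hm⟩
      rw [← hm]
      exact hip.exact.apply_apply_eq_zero _

end GCFlat

/-- Over a commutative noetherian ring `R` with semidualizing module `C`,
the class of `G_C`-flat modules is closed under extensions, kernels of epimorphisms,
and direct summands. -/
theorem stmt0 (R : Type u) [CommRing R] [IsNoetherianRing R]
    (C : ModuleCat.{u} R) (hC : IsSemidualizing R C) :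
    (∀ (M' M M'' : ModuleCat.{u} R) (f : ↥M' →ₗ[R] ↥M) (g : ↥M →ₗ[R] ↥M''),
        Function.Injective f → Function.Surjective g → Function.Exact f g →
        ((IsGCFlat R C M' → IsGCFlat R C M'' → IsGCFlat R C M) ∧
         (IsGCFlat R C M → IsGCFlat R C M'' → IsGCFlat R C M'))) ∧
    (∀ (M N : ModuleCat.{u} R), IsGCFlat R C M →
        (∃ (ι : ↥N →ₗ[R] ↥M) (π : ↥M →ₗ[R] ↥N), π.comp ι = LinearMap.id) →
        IsGCFlat R C N) := by
  exact ⟨fun _ _ _ _ _ hf hg h =>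
      ⟨hC.isGCFlat_extension ⟨hf, hg, h⟩, hC.isGCFlat_kernel ⟨hf, hg, h⟩⟩,
    fun _ _ hM ⟨j, r, hr⟩ => hC.isGCFlat_of_retract hM j r hr⟩
end

section
/- Let R be a commutative noetherian ring and C a semidualizing R-module. The class of R-modules of finite C-flat C-cotorsion projective dimension is closed under extensions, cokernels of monomorphisms, and direct summands: for every short exact sequence 0 → M_1 → M_2 → M_3 → 0 of R-modules, if M_1 and M_3 have finite C-flat C-cotorsion projective dimension then so does M_2, and if M_1 and M_2 have finite C-flat C-cotorsion projective dimension then so does M_3; moreover, every direct summand of a module of finite C-flat C-cotorsion projective dimension has finite C-flat C-cotorsion projective dimension. -/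
open CategoryTheory TensorProduct

universe u

section ExtVanishing

variable {R : Type u} [CommRing R]

lemma extZero_iff {M : ModuleCat.{u} R} (P : ProjectiveResolution M) (N : ModuleCat.{u} R) :
    extZero R M N ↔ ∀ (n : ℕ) (φ : P.complex.X (n + 1) →ₗ[R] N),
      φ ∘ₗ (P.complex.d (n + 2) (n + 1)).hom = 0 →
        ∃ ψ : P.complex.X n →ₗ[R] N, ψ ∘ₗ (P.complex.d (n + 1) n).hom = φ := by
  have key (n : ℕ) : Subsingleton (((Ext R (ModuleCat.{u} R) (n + 1)).obj (Opposite.op M)).obj N) ↔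
      ∀ (φ : P.complex.X (n + 1) →ₗ[R] N),
      φ ∘ₗ (P.complex.d (n + 2) (n + 1)).hom = 0 →
        ∃ ψ : P.complex.X n →ₗ[R] N, ψ ∘ₗ (P.complex.d (n + 1) n).hom = φ := by
    rw [← ModuleCat.isZero_iff_subsingleton, (P.isoExt (R := R) (n + 1) N).isZero_iff,
      ← HomologicalComplex.exactAt_iff_isZero_homology,
      HomologicalComplex.exactAt_iff' _ n (n + 1) (n + 2) (by simp) (by simp),
      ShortComplex.moduleCat_exact_iff]
    constructor
    · intro h φ hφ
      obtain ⟨ψ, hψ⟩ := h (ModuleCat.ofHom φ) (by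
        change P.complex.d (n + 2) (n + 1) ≫ ModuleCat.ofHom φ = 0
        ext1; exact hφ)
      exact ⟨ModuleCat.Hom.hom ψ, congrArg ModuleCat.Hom.hom hψ⟩
    · intro h φ hφ
      obtain ⟨ψ, hψ⟩ := h (ModuleCat.Hom.hom φ) (congrArg ModuleCat.Hom.hom hφ)
      refine ⟨ModuleCat.ofHom ψ, ?_⟩
      change P.complex.d (n + 1) n ≫ ModuleCat.ofHom ψ = φ
      ext1; exact hψ
  constructor
  · exact fun h n => (key n).1 (h (n + 1) (by omega))
  · rintro h (_ | n) hn
    · omega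
    · exact (key n).2 (h n)

namespace CategoryTheory.ProjectiveResolution

variable {M : ModuleCat.{u} R} (P : ProjectiveResolution M)

/-- The augmentation of a projective resolution, as a linear map. -/
noncomputable def augmentation : P.complex.X 0 →ₗ[R] M := (P.π.f 0).hom

lemma augmentation_surjective : Function.Surjective P.augmentation :=
  (ModuleCat.epi_iff_surjective (P.π.f 0)).1 inferInstance

lemma exact_d_augmentation : Function.Exact (P.complex.d 1 0).hom P.augmentation :=
  (ShortComplex.ShortExact.moduleCat_exact_iff_function_exact _).1 P.exact₀

lemma exact_d_d (n : ℕ) :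
    Function.Exact (P.complex.d (n + 2) (n + 1)).hom (P.complex.d (n + 1) n).hom :=
  (ShortComplex.ShortExact.moduleCat_exact_iff_function_exact _).1 (P.exact_succ n)

end CategoryTheory.ProjectiveResolution

end ExtVanishing

section FiniteFreeResolution

variable {R : Type u} [CommRing R]

/-- The projective resolution attached to an exact sequence of projective modules. -/
noncomputable def projectiveResolutionOfExact {M : ModuleCat.{u} R} (P : ℕ → ModuleCat.{u} R)
    (hP : ∀ i, Projective (P i))
    (d : ∀ i : ℕ, ↥(P (i + 1)) →ₗ[R] ↥(P i)) (ε : ↥(P 0) →ₗ[R] ↥M)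
    (hε : Function.Surjective ε) (h₀ : Function.Exact (d 0) ε)
    (hd : ∀ i : ℕ, Function.Exact (d (i + 1)) (d i)) : ProjectiveResolution M where
  complex := ChainComplex.of P (fun i => ModuleCat.ofHom (d i))
    (fun i => by ext x; exact (hd i).apply_apply_eq_zero x)
  projective := hP
  π := (ChainComplex.toSingle₀Equiv _ _).symm ⟨ModuleCat.ofHom ε, by
    refine (congrArg (· ≫ ModuleCat.ofHom ε)
      (ChainComplex.of_d P (fun i => ModuleCat.ofHom (d i)) 0)).trans ?_
    ext x
    exact h₀.apply_apply_eq_zero x⟩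
  quasiIso := ⟨fun n => by
    cases n
    · rw [ChainComplex.quasiIsoAt₀_iff, ShortComplex.quasiIso_iff_of_zeros']
      · dsimp
        refine (ShortComplex.exact_and_epi_g_iff_of_iso (S₂ := ShortComplex.mk
          (ModuleCat.ofHom (d 0)) (ModuleCat.ofHom ε)
          (by ext x; exact h₀.apply_apply_eq_zero x)) ?_).2
          ⟨(ShortComplex.ShortExact.moduleCat_exact_iff_function_exact _).2 h₀,
            (ModuleCat.epi_iff_surjective _).2 hε⟩
        exact ShortComplex.isoMk (Iso.refl _) (Iso.refl _) (Iso.refl _)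
          (by
            refine (Category.id_comp _).trans (Eq.trans ?_ (Category.comp_id _).symm)
            exact (ChainComplex.of_d P (fun i => ModuleCat.ofHom (d i)) 0).symm)
          (by
            refine (Category.id_comp _).trans (Eq.trans ?_ (Category.comp_id _).symm)
            exact (ChainComplex.toSingle₀Equiv_symm_apply_f_zero
              (C := ChainComplex.of P (fun i => ModuleCat.ofHom (d i)) _) (X := M)
              (ModuleCat.ofHom ε) _).symm)
      all_goals rfl
    · rename_i n
      rw [quasiIsoAt_iff_exactAt']
      · rw [HomologicalComplex.exactAt_iff' _ (n + 1 + 1) (n + 1) n (by simp) (by simp)]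
        simp only [HomologicalComplex.sc', HomologicalComplex.shortComplexFunctor',
          ChainComplex.of_d]
        exact (ShortComplex.ShortExact.moduleCat_exact_iff_function_exact _).2 (hd n)
      · apply ChainComplex.exactAt_succ_single_obj⟩

lemma exact_comp_comp {A B C D E : Type*} [AddCommGroup A] [AddCommGroup B] [AddCommGroup C]
    [AddCommGroup D] [AddCommGroup E] [Module R A] [Module R B] [Module R C] [Module R D]
    [Module R E] (p : A →ₗ[R] B) (i : B →ₗ[R] C) (q : C →ₗ[R] D) (j : D →ₗ[R] E)
    (hp : Function.Surjective p) (h : Function.Exact i q) (hj : Function.Injective j) :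
    Function.Exact (i ∘ₗ p) (j ∘ₗ q) := fun x => by
  rw [LinearMap.comp_apply, map_eq_zero_iff j hj, h x]
  constructor
  · rintro ⟨y, rfl⟩
    obtain ⟨z, rfl⟩ := hp y
    exact ⟨z, rfl⟩
  · rintro ⟨z, rfl⟩
    exact ⟨p z, rfl⟩

variable [IsNoetherianRing R]

lemma exists_finite_free_cover (K : ModuleCat.{u} R) [Module.Finite R K] :
    ∃ (P L : ModuleCat.{u} R) (i : L →ₗ[R] P) (p : P →ₗ[R] K),
      Module.Finite R P ∧ Module.Free R P ∧ Module.Finite R L ∧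
        Function.Injective i ∧ Function.Exact i p ∧ Function.Surjective p := by
  obtain ⟨n, p, hp⟩ := Module.Finite.exists_fin' R K
  exact ⟨ModuleCat.of R (Fin n → R), ModuleCat.of R (LinearMap.ker p), (LinearMap.ker p).subtype,
    p, inferInstanceAs (Module.Finite R (Fin n → R)), inferInstanceAs (Module.Free R (Fin n → R)),
    inferInstanceAs (Module.Finite R (LinearMap.ker p)), Subtype.val_injective,
    LinearMap.exact_subtype_ker_map p, hp⟩

lemma exists_finite_free_resolution (M : ModuleCat.{u} R) [hM : Module.Finite R M] :
    ∃ Q : ProjectiveResolution M,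
      ∀ i, Module.Finite R (Q.complex.X i) ∧ Module.Free R (Q.complex.X i) := by
  choose P L i p hP hP' hL hi hip hp using
    fun K : {K : ModuleCat.{u} R // Module.Finite R K} =>
      haveI := K.2; exists_finite_free_cover K.1
  let K : ℕ → {K : ModuleCat.{u} R // Module.Finite R K} :=
    Nat.rec ⟨M, hM⟩ (fun _ K => ⟨L K, hL K⟩)
  refine ⟨projectiveResolutionOfExact (M := M) (fun n => P (K n)) (fun n => ?_)
    (fun n => i (K n) ∘ₗ p (K (n + 1))) (p (K 0)) (hp (K 0))
    (exact_comp_comp (p (K 1)) (i (K 0)) (p (K 0)) LinearMap.id (hp (K 1)) (hip (K 0))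
      Function.injective_id)
    (fun n => exact_comp_comp _ _ _ _ (hp (K (n + 2))) (hip (K (n + 1))) (hi (K n))),
    fun n => ⟨hP (K n), hP' (K n)⟩⟩
  have := hP' (K n)
  have : Module.Projective R (P (K n)) := Module.Projective.of_free
  exact (IsProjective.iff_projective _).1 this

end FiniteFreeResolution

section ExtShift

variable {R : Type u} [CommRing R]

lemma exists_comp_eq_of_range_le {P A B : Type*} [AddCommGroup P] [AddCommGroup A]
    [AddCommGroup B] [Module R P] [Module R A] [Module R B]
    (f : A →ₗ[R] B) (hf : Function.Injective f) (φ : P →ₗ[R] B)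
    (h : ∀ x, φ x ∈ LinearMap.range f) : ∃ ψ : P →ₗ[R] A, f ∘ₗ ψ = φ := by
  refine ⟨(LinearEquiv.ofInjective f hf).symm.toLinearMap ∘ₗ φ.codRestrict _ h, ?_⟩
  ext x
  have := congrArg Subtype.val
    ((LinearEquiv.ofInjective f hf).apply_symm_apply (φ.codRestrict _ h x))
  simp

lemma exists_comp_eq_of_ker_le {P A B : Type*} [AddCommGroup P] [AddCommGroup A]
    [AddCommGroup B] [Module R P] [Module R A] [Module R B]
    (p : P →ₗ[R] A) (hp : Function.Surjective p) (φ : P →ₗ[R] B)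
    (h : ∀ x, p x = 0 → φ x = 0) : ∃ ψ : A →ₗ[R] B, ψ ∘ₗ p = φ := by
  refine ⟨(LinearMap.ker p).liftQ φ h ∘ₗ
    (p.quotKerEquivOfSurjective hp).symm.toLinearMap, ?_⟩
  ext x
  have : (p.quotKerEquivOfSurjective hp).symm (p x) = (LinearMap.ker p).mkQ x := by
    rw [LinearEquiv.symm_apply_eq]; rfl
  rw [LinearMap.comp_apply, LinearMap.comp_apply, LinearEquiv.coe_coe, this]
  rfl

variable {M N' N N'' : ModuleCat.{u} R} {f : N' →ₗ[R] N} {g : N →ₗ[R] N''}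

/-- When `Ext` of `M` with the kernel vanishes, a cocycle with values in a quotient lifts to a
cocycle. -/
lemma exists_lift_cocycle (P : ProjectiveResolution M) (hf : Function.Injective f)
    (hg : Function.Surjective g) (hfg : Function.Exact f g) (h : extZero R M N') (n : ℕ)
    (φ : P.complex.X n →ₗ[R] N'') (hφ : φ ∘ₗ (P.complex.d (n + 1) n).hom = 0) :
    ∃ ψ : P.complex.X n →ₗ[R] N, g ∘ₗ ψ = φ ∧ ψ ∘ₗ (P.complex.d (n + 1) n).hom = 0 := by
  have : Module.Projective R (P.complex.X n) :=
    (IsProjective.iff_projective (R := R) _).2 (P.projective n)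
  obtain ⟨ψ, hψ⟩ := Module.projective_lifting_property g φ hg
  obtain ⟨χ, hχ⟩ := exists_comp_eq_of_range_le f hf (ψ ∘ₗ (P.complex.d (n + 1) n).hom)
    (fun x => (hfg _).1 (by
      have := LinearMap.congr_fun hφ x
      rwa [← hψ] at this))
  obtain ⟨θ, hθ⟩ := (extZero_iff P N').1 h n χ (by
    ext x
    apply hf
    have h1 := LinearMap.congr_fun hχ ((P.complex.d (n + 2) (n + 1)).hom x)
    have h2 := (P.exact_d_d n).apply_apply_eq_zero x
    simp only [LinearMap.comp_apply] at h1 ⊢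
    rw [h1, h2]
    simp)
  refine ⟨ψ - f ∘ₗ θ, ?_, ?_⟩
  · ext x
    have := LinearMap.congr_fun hψ x
    simp only [LinearMap.comp_apply] at this
    simp [hfg.apply_apply_eq_zero, this]
  · rw [LinearMap.sub_comp, LinearMap.comp_assoc, hθ, hχ, sub_self]

lemma exists_lift_of_extZero (hf : Function.Injective f) (hg : Function.Surjective g)
    (hfg : Function.Exact f g) (h : extZero R M N') (φ : M →ₗ[R] N'') :
    ∃ ψ : M →ₗ[R] N, g ∘ₗ ψ = φ := by
  let P := ProjectiveResolution.of M
  obtain ⟨ψ, hψ, hψ'⟩ := exists_lift_cocycle P hf hg hfg h 0 (φ ∘ₗ P.augmentation) (by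
    ext x
    simp [P.exact_d_augmentation.apply_apply_eq_zero])
  obtain ⟨θ, hθ⟩ := exists_comp_eq_of_ker_le P.augmentation P.augmentation_surjective ψ
    (fun x hx => by
      obtain ⟨y, rfl⟩ := (P.exact_d_augmentation x).1 hx
      exact LinearMap.congr_fun hψ' y)
  refine ⟨θ, ?_⟩
  rw [← LinearMap.cancel_right P.augmentation_surjective, LinearMap.comp_assoc, hθ, hψ]

lemma extZero_of_shortExact (hf : Function.Injective f) (hg : Function.Surjective g)
    (hfg : Function.Exact f g) (h' : extZero R M N') (h : extZero R M N) :
    extZero R M N'' := by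
  let P := ProjectiveResolution.of M
  refine (extZero_iff P N'').2 fun n φ hφ => ?_
  obtain ⟨ψ, rfl, hψ'⟩ := exists_lift_cocycle P hf hg hfg h' (n + 1) φ hφ
  obtain ⟨θ, rfl⟩ := (extZero_iff P N).1 h n ψ hψ'
  exact ⟨g ∘ₗ θ, rfl⟩

lemma extZero_of_retract {A B : ModuleCat.{u} R} (ι : A →ₗ[R] B) (π : B →ₗ[R] A)
    (h : π ∘ₗ ι = LinearMap.id) (hB : extZero R M B) : extZero R M A := by
  let P := ProjectiveResolution.of M
  refine (extZero_iff P A).2 fun n φ hφ => ?_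
  obtain ⟨ψ, hψ⟩ := (extZero_iff P B).1 hB n (ι ∘ₗ φ) (by
    rw [LinearMap.comp_assoc, hφ, LinearMap.comp_zero])
  exact ⟨π ∘ₗ ψ, by rw [LinearMap.comp_assoc, hψ, ← LinearMap.comp_assoc, h, LinearMap.id_comp]⟩

lemma extZero_prod {A B : ModuleCat.{u} R} (hA : extZero R M A) (hB : extZero R M B) :
    extZero R M (ModuleCat.of R (A × B)) := by
  let P := ProjectiveResolution.of M
  refine (extZero_iff P _).2 fun n φ hφ => ?_
  obtain ⟨ψ₁, h₁⟩ := (extZero_iff P A).1 hA n (LinearMap.fst R A B ∘ₗ φ) (by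
    rw [LinearMap.comp_assoc, hφ, LinearMap.comp_zero])
  obtain ⟨ψ₂, h₂⟩ := (extZero_iff P B).1 hB n (LinearMap.snd R A B ∘ₗ φ) (by
    rw [LinearMap.comp_assoc, hφ, LinearMap.comp_zero])
  refine ⟨ψ₁.prod ψ₂, LinearMap.ext fun x => ?_⟩
  exact Prod.ext (LinearMap.congr_fun h₁ x) (LinearMap.congr_fun h₂ x)

lemma extZero_of_subsingleton (N : ModuleCat.{u} R) [Subsingleton N] : extZero R M N :=
  (extZero_iff (ProjectiveResolution.of M) N).2 fun _ _ _ =>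
    ⟨0, LinearMap.ext fun _ => Subsingleton.elim _ _⟩

end ExtShift

section TensorHom

variable {R : Type u} [CommRing R]

section

variable {A B C F : Type*} [AddCommGroup A] [AddCommGroup B] [AddCommGroup C] [AddCommGroup F]
  [Module R A] [Module R B] [Module R C] [Module R F]

lemma lTensorHomToHomLTensor_bijective [Module.Finite R A] [Module.Projective R A] :
    Function.Bijective (TensorProduct.lTensorHomToHomLTensor (.id R) A F C) := by
  convert (lTensorHomEquivHomLTensor R A F C).bijective using 1
  ext x : 1
  exact (lTensorHomEquivHomLTensor_apply x).symm

lemma lTensorHomToHomLTensor_lcomp (d : A →ₗ[R] B) (x : F ⊗[R] (B →ₗ[R] C)) :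
    TensorProduct.lTensorHomToHomLTensor (.id R) A F C
      (LinearMap.lTensor F (LinearMap.lcomp R C d) x) =
    TensorProduct.lTensorHomToHomLTensor (.id R) B F C x ∘ₗ d := by
  induction x with
  | zero => simp
  | add x y hx hy => simp only [map_add, hx, hy, LinearMap.add_comp]
  | tmul f g => ext a; simp

end

section Semidualizing

variable [IsNoetherianRing R] {C : ModuleCat.{u} R} (F : ModuleCat.{u} R) [Module.Flat R F]

lemma extZero_flat_tensor [Module.Finite R C] {N : ModuleCat.{u} R} (h : extZero R C N) :
    extZero R C (ModuleCat.of R (F ⊗[R] N)) := by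
  obtain ⟨P, hP⟩ := exists_finite_free_resolution C
  have hb (n : ℕ) : Function.Bijective
      (TensorProduct.lTensorHomToHomLTensor (.id R) (P.complex.X n) F N) :=
    have := (hP n).1
    have := (hP n).2
    lTensorHomToHomLTensor_bijective
  refine (extZero_iff P _).2 fun n φ hφ => ?_
  obtain ⟨x, rfl⟩ := (hb (n + 1)).2 φ
  have hex : Function.Exact (LinearMap.lcomp R N (P.complex.d (n + 1) n).hom)
      (LinearMap.lcomp R N (P.complex.d (n + 2) (n + 1)).hom) := fun φ =>
    ⟨(extZero_iff P N).1 h n φ, by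
      rintro ⟨ψ, rfl⟩
      ext y
      simp [(P.exact_d_d n).apply_apply_eq_zero]⟩
  obtain ⟨y, rfl⟩ := (Module.Flat.lTensor_exact F hex x).1 ((hb (n + 2)).1 (by
    rw [lTensorHomToHomLTensor_lcomp, map_zero]
    exact hφ))
  exact ⟨TensorProduct.lTensorHomToHomLTensor (.id R) (P.complex.X n) F N y,
    (lTensorHomToHomLTensor_lcomp _ y).symm⟩

lemma lTensorHomToHomLTensor_bijective_of_flat [Module.Finite R C] (N : ModuleCat.{u} R) :
    Function.Bijective (TensorProduct.lTensorHomToHomLTensor (.id R) C F N) := by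
  obtain ⟨P, hP⟩ := exists_finite_free_resolution C
  have hb (n : ℕ) : Function.Bijective
      (TensorProduct.lTensorHomToHomLTensor (.id R) (P.complex.X n) F N) :=
    have := (hP n).1
    have := (hP n).2
    lTensorHomToHomLTensor_bijective
  have hinj : Function.Injective (LinearMap.lcomp R N P.augmentation) := fun φ ψ h =>
    (LinearMap.cancel_right P.augmentation_surjective).1 h
  have hex : Function.Exact (LinearMap.lcomp R N P.augmentation)
      (LinearMap.lcomp R N (P.complex.d 1 0).hom) := fun φ => by
    constructor
    · intro h
      refine exists_comp_eq_of_ker_le P.augmentation P.augmentation_surjective φ fun x hx => ?_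
      obtain ⟨y, rfl⟩ := (P.exact_d_augmentation x).1 hx
      exact LinearMap.congr_fun h y
    · rintro ⟨ψ, rfl⟩
      ext y
      simp [P.exact_d_augmentation.apply_apply_eq_zero]
  constructor
  · rw [injective_iff_map_eq_zero]
    intro x hx
    refine (injective_iff_map_eq_zero _).1
      (Module.Flat.lTensor_preserves_injective_linearMap (M := F) _ hinj) x ((hb 0).1 ?_)
    rw [lTensorHomToHomLTensor_lcomp, hx, LinearMap.zero_comp, map_zero]
  · intro φ
    obtain ⟨y, hy⟩ := (hb 0).2 (φ ∘ₗ P.augmentation)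
    obtain ⟨x, rfl⟩ := (Module.Flat.lTensor_exact F hex y).1 ((hb 1).1 (by
      rw [lTensorHomToHomLTensor_lcomp, hy, map_zero]
      ext z
      simp [P.exact_d_augmentation.apply_apply_eq_zero]))
    refine ⟨x, ?_⟩
    rw [lTensorHomToHomLTensor_lcomp] at hy
    exact (LinearMap.cancel_right P.augmentation_surjective).1 hy

lemma mk_bijective_of_flat (hC : IsSemidualizing R C) :
    Function.Bijective (TensorProduct.mk R F C) := by
  have := hC.1
  have h : ⇑(TensorProduct.mk R F C) =
      TensorProduct.lTensorHomToHomLTensor (.id R) C F C ∘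
        (LinearEquiv.ofBijective _ hC.2.1).lTensor F ∘ (TensorProduct.rid R F).symm := by
    ext x c
    simp
  rw [h]
  exact (lTensorHomToHomLTensor_bijective_of_flat F C).comp
    (((LinearEquiv.ofBijective _ hC.2.1).lTensor F).bijective.comp
      (TensorProduct.rid R F).symm.bijective)

end Semidualizing

end TensorHom

section FlatCotorsion

variable {R : Type u} [CommRing R] {C : ModuleCat.{u} R}

lemma IsCFlatCotorsion.of_subsingleton (M : ModuleCat.{u} R) [Subsingleton M] :
    IsCFlatCotorsion R C M := by
  have : Subsingleton (M ⊗[R] C) := subsingleton_of_forall_eq 0 fun x => by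
    induction x with
    | zero => rfl
    | add x y hx hy => rw [hx, hy, add_zero]
    | tmul m c => rw [Subsingleton.elim m 0, TensorProduct.zero_tmul]
  exact ⟨M, inferInstance, fun _ _ => extZero_of_subsingleton M,
    ⟨LinearEquiv.ofSubsingleton _ _⟩⟩

lemma IsCFlatCotorsion.of_equiv {M N : ModuleCat.{u} R} (h : IsCFlatCotorsion R C M)
    (e : N ≃ₗ[R] M) : IsCFlatCotorsion R C N := by
  obtain ⟨F, h₁, h₂, ⟨e'⟩⟩ := h
  exact ⟨F, h₁, h₂, ⟨e.trans e'⟩⟩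

lemma flat_prod (F G : Type u) [AddCommGroup F] [Module R F] [AddCommGroup G] [Module R G]
    [Module.Flat R F] [Module.Flat R G] : Module.Flat R (F × G) := by
  refine Module.Flat.iff_lTensor_preserves_injective_linearMap.2 fun N N' _ _ _ _ f hf => ?_
  have h : LinearMap.lTensor (F × G) f = (TensorProduct.prodLeft R R F G N').symm.toLinearMap ∘ₗ
      (LinearMap.lTensor F f).prodMap (LinearMap.lTensor G f) ∘ₗ
        (TensorProduct.prodLeft R R F G N).toLinearMap := by
    rw [LinearEquiv.eq_toLinearMap_symm_comp]
    ext <;> simp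
  rw [h]
  exact (TensorProduct.prodLeft R R F G N').symm.injective.comp
    (((Module.Flat.lTensor_preserves_injective_linearMap (M := F) f hf).prodMap
      (Module.Flat.lTensor_preserves_injective_linearMap (M := G) f hf)).comp
        (TensorProduct.prodLeft R R F G N).injective)

lemma IsCFlatCotorsion.prod {M N : ModuleCat.{u} R} (hM : IsCFlatCotorsion R C M)
    (hN : IsCFlatCotorsion R C N) : IsCFlatCotorsion R C (ModuleCat.of R (M × N)) := by
  obtain ⟨F, h₁, h₂, ⟨e⟩⟩ := hM
  obtain ⟨G, h₃, h₄, ⟨e'⟩⟩ := hN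
  exact ⟨ModuleCat.of R (F × G), flat_prod F G,
    fun K hK => extZero_prod (h₂ K hK) (h₄ K hK),
    ⟨(e.prodCongr e').trans (TensorProduct.prodLeft R R F G C).symm⟩⟩

variable [IsNoetherianRing R]

lemma IsCFlatCotorsion.extZero (hC : IsSemidualizing R C)
    {M : ModuleCat.{u} R} (h : IsCFlatCotorsion R C M) :
    extZero R C M := by
  obtain ⟨F, h₁, -, ⟨e⟩⟩ := h
  have := hC.1
  exact extZero_of_retract (B := ModuleCat.of R (F ⊗[R] C)) e.toLinearMap e.symm.toLinearMap
    (by ext; simp) (extZero_flat_tensor F hC.2.2)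

lemma IsCFlatCotorsion.exists_hom_equiv (hC : IsSemidualizing R C)
    {M : ModuleCat.{u} R} (h : IsCFlatCotorsion R C M) :
    ∃ F : ModuleCat.{u} R, Module.Flat R F ∧ IsCotorsion R F ∧ Nonempty (F ≃ₗ[R] (C →ₗ[R] M)) := by
  obtain ⟨F, h₁, h₂, ⟨e⟩⟩ := h
  exact ⟨F, h₁, h₂, ⟨(LinearEquiv.ofBijective _ (mk_bijective_of_flat F hC)).trans
    (LinearEquiv.congrRight e.symm)⟩⟩

lemma IsCFlatCotorsion.isCotorsion_hom (hC : IsSemidualizing R C)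
    {M : ModuleCat.{u} R} (h : IsCFlatCotorsion R C M) :
    IsCotorsion R (ModuleCat.of R (C →ₗ[R] M)) := by
  obtain ⟨F, h₁, h₂, ⟨e⟩⟩ := h.exists_hom_equiv hC
  exact fun K hK => extZero_of_retract (A := ModuleCat.of R (C →ₗ[R] M)) e.symm.toLinearMap
    e.toLinearMap (by ext; simp) (h₂ K hK)

lemma IsCFlatCotorsion.evalMap_bijective (hC : IsSemidualizing R C)
    {M : ModuleCat.{u} R} (h : IsCFlatCotorsion R C M) :
    Function.Bijective (evalMap R C M) := by
  obtain ⟨F, h₁, h₂, ⟨e⟩⟩ := h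
  let θ : F ≃ₗ[R] (C →ₗ[R] M) := (LinearEquiv.ofBijective _ (mk_bijective_of_flat F hC)).trans
    (LinearEquiv.congrRight e.symm)
  let η : (C ⊗[R] F) ≃ₗ[R] (C ⊗[R] (C →ₗ[R] M)) := θ.lTensor C
  have h : evalMap R C M =
      ((η.symm.trans (TensorProduct.comm R C F)).trans e.symm).toLinearMap := by
    rw [← LinearMap.cancel_right η.surjective]
    ext c x
    simp [η, θ, evalMap]
    rfl
  rw [h]
  exact LinearEquiv.bijective _

lemma IsCFlatCotorsion.of_retract (hC : IsSemidualizing R C)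
    {M N : ModuleCat.{u} R} (h : IsCFlatCotorsion R C M)
    (ι : N →ₗ[R] M) (π : M →ₗ[R] N) (hπι : π ∘ₗ ι = LinearMap.id) :
    IsCFlatCotorsion R C N := by
  obtain ⟨F, h₁, -, ⟨e⟩⟩ := h.exists_hom_equiv hC
  let ι' : (C →ₗ[R] N) →ₗ[R] (C →ₗ[R] M) := LinearMap.compRight R ι
  let π' : (C →ₗ[R] M) →ₗ[R] (C →ₗ[R] N) := LinearMap.compRight R π
  have hι' : π' ∘ₗ ι' = LinearMap.id := by
    ext φ c
    exact LinearMap.congr_fun hπι (φ c)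
  have hM : Module.Flat R (C →ₗ[R] M) := Module.Flat.of_linearEquiv e.symm
  have hb := h.evalMap_bijective hC
  have hι'' : ι ∘ₗ evalMap R C N = evalMap R C M ∘ₗ ι'.lTensor C := by
    ext; simp [evalMap, ι']
  have hπ'' : π ∘ₗ evalMap R C M = evalMap R C N ∘ₗ π'.lTensor C := by
    ext; simp [evalMap, π']
  have hbN : Function.Bijective (evalMap R C N) := by
    constructor
    · have hi : Function.Injective (ι'.lTensor C) := Function.LeftInverse.injective
        (g := π'.lTensor C) fun x => by
          rw [← LinearMap.comp_apply, ← LinearMap.lTensor_comp, hι', LinearMap.lTensor_id,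
            LinearMap.id_apply]
      have : Function.Injective (ι ∘ evalMap R C N) := by
        rw [← LinearMap.coe_comp, hι'', LinearMap.coe_comp]
        exact hb.1.comp hi
      exact this.of_comp
    · have hs : Function.Surjective π := fun x => ⟨ι x, LinearMap.congr_fun hπι x⟩
      have : Function.Surjective (evalMap R C N ∘ π'.lTensor C) := by
        rw [← LinearMap.coe_comp, ← hπ'', LinearMap.coe_comp]
        exact hs.comp hb.2
      exact this.of_comp
  exact ⟨ModuleCat.of R (C →ₗ[R] N), Module.Flat.of_retract ι' π' hι',
    fun K hK => extZero_of_retract (A := ModuleCat.of R (C →ₗ[R] N))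
      (B := ModuleCat.of R (C →ₗ[R] M)) ι' π' hι' (h.isCotorsion_hom hC K hK),
    ⟨((TensorProduct.comm R _ _).trans (LinearEquiv.ofBijective _ hbN)).symm⟩⟩

end FlatCotorsion

section FiniteResolution

variable {R : Type u} [CommRing R] {C : ModuleCat.{u} R}

/-- `M` has a resolution of length at most `n` by `C`-flat `C`-cotorsion modules, described
one syzygy at a time. -/
def HasFiniteRes (C : ModuleCat.{u} R) : ℕ → ModuleCat.{u} R → Prop
  | 0, M => IsCFlatCotorsion R C M
  | n + 1, M => ∃ (K X : ModuleCat.{u} R) (f : K →ₗ[R] X) (g : X →ₗ[R] M),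
      Function.Injective f ∧ Function.Surjective g ∧ Function.Exact f g ∧
      IsCFlatCotorsion R C X ∧ HasFiniteRes C n K

lemma HasFiniteRes.of_equiv {n : ℕ} {M N : ModuleCat.{u} R} (h : HasFiniteRes C n M)
    (e : N ≃ₗ[R] M) : HasFiniteRes C n N := by
  cases n with
  | zero => exact IsCFlatCotorsion.of_equiv h e
  | succ n =>
    obtain ⟨K, X, f, g, hf, hg, hfg, hX, hK⟩ := h
    refine ⟨K, X, f, e.symm.toLinearMap ∘ₗ g, hf, e.symm.surjective.comp hg, fun x => ?_, hX, hK⟩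
    rw [← hfg x]
    simp

lemma HasFiniteRes.succ {n : ℕ} {M : ModuleCat.{u} R} (h : HasFiniteRes C n M) :
    HasFiniteRes C (n + 1) M := by
  induction n generalizing M with
  | zero =>
    refine ⟨ModuleCat.of R PUnit, M, 0, LinearMap.id, Function.injective_of_subsingleton _,
      Function.surjective_id, fun x => ?_, h, IsCFlatCotorsion.of_subsingleton _⟩
    simp [eq_comm]
  | succ n ih =>
    obtain ⟨K, X, f, g, hf, hg, hfg, hX, hK⟩ := h
    exact ⟨K, X, f, g, hf, hg, hfg, hX, ih hK⟩

lemma HasFiniteRes.mono {m n : ℕ} {M : ModuleCat.{u} R} (h : HasFiniteRes C m M) (hmn : m ≤ n) :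
    HasFiniteRes C n M :=
  Nat.le_induction h (fun _ _ h => h.succ) n hmn

lemma HasFiniteRes.of_hasResOfLength {n : ℕ} {M : ModuleCat.{u} R}
    (h : HasResOfLength R (IsCFlatCotorsion R C) n M) : HasFiniteRes C n M := by
  induction n generalizing M with
  | zero =>
    obtain ⟨P, d, ε, hε, h₀, -, hP, hs⟩ := h
    have := hs 1 Nat.one_pos
    have hi : Function.Injective ε := (injective_iff_map_eq_zero ε).2 fun x hx => by
      obtain ⟨y, rfl⟩ := (h₀ x).1 hx
      rw [Subsingleton.elim y 0, map_zero]
    exact (hP 0 le_rfl).of_equiv (LinearEquiv.ofBijective ε ⟨hi, hε⟩).symm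
  | succ n ih =>
    obtain ⟨P, d, ε, hε, h₀, hd, hP, hs⟩ := h
    refine ⟨ModuleCat.of R (LinearMap.ker ε), P 0, (LinearMap.ker ε).subtype, ε,
      Subtype.val_injective, hε, LinearMap.exact_subtype_ker_map ε, hP 0 (Nat.zero_le _),
      ih ⟨fun i => P (i + 1), fun i => d (i + 1),
        (d 0).codRestrict _ fun x => h₀.apply_apply_eq_zero x, ?_, ?_, fun i => hd (i + 1),
        fun i hi => hP (i + 1) (Nat.succ_le_succ hi), fun i hi => hs (i + 1) (Nat.succ_lt_succ hi)⟩⟩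
    · rintro ⟨x, hx⟩
      obtain ⟨y, rfl⟩ := (h₀ x).1 hx
      exact ⟨y, rfl⟩
    · intro x
      rw [← hd 0 x, ← Subtype.val_inj]
      rfl

lemma HasFiniteRes.hasResOfLength {n : ℕ} {M : ModuleCat.{u} R} (h : HasFiniteRes C n M) :
    HasResOfLength R (IsCFlatCotorsion R C) n M := by
  induction n generalizing M with
  | zero =>
    refine ⟨fun | 0 => M | _ + 1 => ModuleCat.of R PUnit, fun _ => 0, LinearMap.id,
      Function.surjective_id, fun x => by simp [eq_comm], fun i x => ?_, fun i hi => ?_,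
      fun i hi => ?_⟩
    · simp
    · obtain rfl := Nat.le_zero.1 hi
      exact h
    · obtain ⟨j, rfl⟩ := Nat.exists_eq_succ_of_ne_zero hi.ne'
      exact inferInstanceAs (Subsingleton PUnit)
  | succ n ih =>
    obtain ⟨K, X, f, g, hf, hg, hfg, hX, hK⟩ := h
    obtain ⟨P, d, ε, hε, h₀, hd, hP, hs⟩ := ih hK
    refine ⟨fun | 0 => X | i + 1 => P i, fun | 0 => f ∘ₗ ε | i + 1 => d i, g, hg, fun x => ?_,
      fun i => ?_, fun i hi => ?_, fun i hi => ?_⟩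
    · rw [hfg x]
      exact (hε.range_comp f).symm ▸ Iff.rfl
    · cases i with
      | zero =>
        intro x
        rw [← h₀ x]
        exact map_eq_zero_iff f hf
      | succ i => exact hd i
    · cases i with
      | zero => exact hX
      | succ i => exact hP i (Nat.le_of_succ_le_succ hi)
    · cases i with
      | zero => exact absurd hi (Nat.not_lt_zero _)
      | succ i => exact hs i (Nat.lt_of_succ_lt_succ hi)

lemma hasResOfLength_iff (n : ℕ) (M : ModuleCat.{u} R) :
    HasResOfLength R (IsCFlatCotorsion R C) n M ↔ HasFiniteRes C n M :=
  ⟨HasFiniteRes.of_hasResOfLength, HasFiniteRes.hasResOfLength⟩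

lemma exact_compRight {N' N N'' : ModuleCat.{u} R} {f : N' →ₗ[R] N} {g : N →ₗ[R] N''}
    (hf : Function.Injective f) (hfg : Function.Exact f g) :
    Function.Exact (LinearMap.compRight R f : (C →ₗ[R] N') →ₗ[R] (C →ₗ[R] N))
      (LinearMap.compRight R g : (C →ₗ[R] N) →ₗ[R] (C →ₗ[R] N'')) := by
  refine fun φ => ⟨fun h => exists_comp_eq_of_range_le f hf φ fun x =>
    (hfg _).1 (LinearMap.congr_fun h x), ?_⟩
  rintro ⟨ψ, rfl⟩
  ext x
  exact hfg.apply_apply_eq_zero (ψ x)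

lemma compRight_injective {N' N : ModuleCat.{u} R} {f : N' →ₗ[R] N}
    (hf : Function.Injective f) :
    Function.Injective (LinearMap.compRight R f : (C →ₗ[R] N') →ₗ[R] (C →ₗ[R] N)) :=
  fun _ _ h => (LinearMap.cancel_left hf).1 h

variable [IsNoetherianRing R]

lemma HasFiniteRes.extZero_and_isCotorsion_hom (hC : IsSemidualizing R C)
    {n : ℕ} {L : ModuleCat.{u} R}
    (h : HasFiniteRes C n L) :
    extZero R C L ∧ IsCotorsion R (ModuleCat.of R (C →ₗ[R] L)) := by
  induction n generalizing L with
  | zero => exact ⟨IsCFlatCotorsion.extZero hC h, IsCFlatCotorsion.isCotorsion_hom hC h⟩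
  | succ n ih =>
    obtain ⟨K, X, f, g, hf, hg, hfg, hX, hK⟩ := h
    obtain ⟨h₁, h₂⟩ := ih hK
    refine ⟨extZero_of_shortExact hf hg hfg h₁ (hX.extZero hC), fun F hF => ?_⟩
    exact extZero_of_shortExact (N' := ModuleCat.of R (C →ₗ[R] K))
      (N := ModuleCat.of R (C →ₗ[R] X)) (N'' := ModuleCat.of R (C →ₗ[R] L))
      (f := LinearMap.compRight R f) (g := LinearMap.compRight R g)
      (compRight_injective hf) (fun φ => exists_lift_of_extZero hf hg hfg h₁ φ)
      (exact_compRight hf hfg) (h₂ F hF) (hX.isCotorsion_hom hC F hF)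

lemma HasFiniteRes.exists_lift (hC : IsSemidualizing R C)
    {n : ℕ} {L N N'' X : ModuleCat.{u} R} (hL : HasFiniteRes C n L)
    {f : L →ₗ[R] N} {g : N →ₗ[R] N''} (hf : Function.Injective f) (hg : Function.Surjective g)
    (hfg : Function.Exact f g) (hX : IsCFlatCotorsion R C X) (φ : X →ₗ[R] N'') :
    ∃ ψ : X →ₗ[R] N, g ∘ₗ ψ = φ := by
  obtain ⟨F, hF, -, ⟨e⟩⟩ := hX
  obtain ⟨h₁, h₂⟩ := hL.extZero_and_isCotorsion_hom hC
  obtain ⟨ψ, hψ⟩ := exists_lift_of_extZero (N' := ModuleCat.of R (C →ₗ[R] L))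
    (N := ModuleCat.of R (C →ₗ[R] N)) (N'' := ModuleCat.of R (C →ₗ[R] N''))
    (f := LinearMap.compRight R f) (g := LinearMap.compRight R g)
    (compRight_injective hf) (fun φ => exists_lift_of_extZero hf hg hfg h₁ φ)
    (exact_compRight hf hfg) (h₂ F hF) (TensorProduct.curry (φ ∘ₗ e.symm.toLinearMap))
  refine ⟨TensorProduct.lift (σ₁₂ := RingHom.id R) ψ ∘ₗ e.toLinearMap, ?_⟩
  rw [← LinearMap.comp_assoc, ← LinearEquiv.eq_comp_toLinearMap_symm]
  refine TensorProduct.ext' fun x c => ?_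
  exact LinearMap.congr_fun (LinearMap.congr_fun hψ x) c

lemma HasFiniteRes.extension (hC : IsSemidualizing R C)
    (n : ℕ) {M₁ M₂ M₃ : ModuleCat.{u} R} {f : M₁ →ₗ[R] M₂}
    {g : M₂ →ₗ[R] M₃} (hf : Function.Injective f) (hg : Function.Surjective g)
    (hfg : Function.Exact f g) (h₁ : HasFiniteRes C n M₁) (h₃ : HasFiniteRes C n M₃) :
    HasFiniteRes C n M₂ := by
  induction n generalizing M₁ M₂ M₃ with
  | zero =>
    obtain ⟨s, hs⟩ := h₁.exists_lift hC hf hg hfg h₃ LinearMap.id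
    have hs (x) : g (s x) = x := LinearMap.congr_fun hs x
    refine (IsCFlatCotorsion.prod h₁ h₃).of_equiv
      (LinearEquiv.ofBijective (f.coprod s) ⟨?_, fun y => ?_⟩).symm
    · rw [injective_iff_map_eq_zero]
      rintro ⟨x, y⟩ h
      rw [LinearMap.coprod_apply] at h
      obtain rfl : y = 0 := by
        simpa [hfg.apply_apply_eq_zero, hs] using congrArg g h
      rw [map_zero, add_zero, map_eq_zero_iff f hf] at h
      exact Prod.ext h rfl
    · obtain ⟨x, hx⟩ := (hfg (y - s (g y))).1 (by rw [map_sub, hs, sub_self])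
      exact ⟨(x, g y), by rw [LinearMap.coprod_apply, hx, sub_add_cancel]⟩
  | succ n ih =>
    have hlift {X : ModuleCat.{u} R} (hX : IsCFlatCotorsion R C X) (φ : X →ₗ[R] M₃) :=
      h₁.exists_lift hC hf hg hfg hX φ
    obtain ⟨K₁, X₁, i₁, p₁, hi₁, hp₁, hip₁, hX₁, hK₁⟩ := h₁
    obtain ⟨K₃, X₃, i₃, p₃, hi₃, hp₃, hip₃, hX₃, hK₃⟩ := h₃
    obtain ⟨s, hs⟩ := hlift hX₃ p₃
    have hs (x) : g (s x) = p₃ x := LinearMap.congr_fun hs x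
    let Φ : X₁ × X₃ →ₗ[R] M₂ := (f ∘ₗ p₁).coprod s
    have hΦ (x : X₁ × X₃) : Φ x = f (p₁ x.1) + s x.2 := rfl
    have hgΦ (x : X₁ × X₃) : g (Φ x) = p₃ x.2 := by
      rw [hΦ, map_add, hfg.apply_apply_eq_zero, zero_add, hs]
    refine ⟨ModuleCat.of R (LinearMap.ker Φ), ModuleCat.of R (X₁ × X₃), (LinearMap.ker Φ).subtype,
      Φ, Subtype.val_injective, fun y => ?_, LinearMap.exact_subtype_ker_map Φ, hX₁.prod hX₃, ?_⟩
    · obtain ⟨x₃, hx₃⟩ := hp₃ (g y)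
      obtain ⟨x, hx⟩ := (hfg (y - s x₃)).1 (by rw [map_sub, hs, hx₃, sub_self])
      obtain ⟨x₁, rfl⟩ := hp₁ x
      exact ⟨(x₁, x₃), by rw [hΦ, hx, sub_add_cancel]⟩
    · let j : K₁ →ₗ[R] LinearMap.ker Φ := (LinearMap.inl R X₁ X₃ ∘ₗ i₁).codRestrict _ fun x => by
        simp [hΦ, hip₁.apply_apply_eq_zero]
      obtain ⟨q, hq⟩ := exists_comp_eq_of_range_le i₃ hi₃
        (LinearMap.snd R X₁ X₃ ∘ₗ (LinearMap.ker Φ).subtype) fun x => (hip₃ _).1 (by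
          have hx : Φ x.1 = 0 := x.2
          have := hgΦ x.1
          rw [hx, map_zero] at this
          exact this.symm)
      have hq (x) : i₃ (q x) = x.1.2 := LinearMap.congr_fun hq x
      refine ih (M₂ := ModuleCat.of R (LinearMap.ker Φ)) (f := j) (g := q) ?_ ?_ ?_ hK₁ hK₃
      · exact fun x y h => hi₁ (congrArg (fun z => z.1.1) h)
      · intro k
        obtain ⟨m, hm⟩ := (hfg (s (i₃ k))).1 (by rw [hs, hip₃.apply_apply_eq_zero])
        obtain ⟨x, rfl⟩ := hp₁ m
        exact ⟨⟨(-x, i₃ k), by simp [hΦ, hm]⟩, hi₃ (hq _)⟩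
      · rintro ⟨⟨x, y⟩, hxy⟩
        rw [← map_eq_zero_iff i₃ hi₃, hq]
        constructor
        · rintro rfl
          rw [LinearMap.mem_ker, hΦ, map_zero, add_zero, map_eq_zero_iff f hf] at hxy
          obtain ⟨k, rfl⟩ := (hip₁ x).1 hxy
          exact ⟨k, rfl⟩
        · rintro ⟨k, hk⟩
          exact (congrArg (fun z => z.1.2) hk).symm

lemma HasFiniteRes.cokernel (hC : IsSemidualizing R C)
    (n : ℕ) {M₁ M₂ M₃ : ModuleCat.{u} R} {f : M₁ →ₗ[R] M₂}
    {g : M₂ →ₗ[R] M₃} (hf : Function.Injective f) (hg : Function.Surjective g)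
    (hfg : Function.Exact f g) (h₁ : HasFiniteRes C n M₁) (h₂ : HasFiniteRes C (n + 1) M₂) :
    HasFiniteRes C (n + 1) M₃ := by
  obtain ⟨K, X, i, p, hi, hp, hip, hX, hK⟩ := h₂
  have hgp : Function.Surjective (g ∘ₗ p) := hg.comp hp
  refine ⟨ModuleCat.of R (LinearMap.ker (g ∘ₗ p)), X, (LinearMap.ker (g ∘ₗ p)).subtype, g ∘ₗ p,
    Subtype.val_injective, hgp, LinearMap.exact_subtype_ker_map _, hX, ?_⟩
  obtain ⟨q, hq⟩ := exists_comp_eq_of_range_le f hf (p ∘ₗ (LinearMap.ker (g ∘ₗ p)).subtype)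
    fun x => (hfg _).1 x.2
  have hq (x) : f (q x) = p x.1 := LinearMap.congr_fun hq x
  let j : K →ₗ[R] LinearMap.ker (g ∘ₗ p) := i.codRestrict _ fun x => by
    simp [hip.apply_apply_eq_zero]
  refine HasFiniteRes.extension hC n (M₂ := ModuleCat.of R (LinearMap.ker (g ∘ₗ p)))
    (f := j) (g := q) ?_ ?_ ?_ hK h₁
  · exact fun x y h => hi (congrArg Subtype.val h)
  · intro x
    obtain ⟨y, hy⟩ := hp (f x)
    exact ⟨⟨y, by simp [hy, hfg.apply_apply_eq_zero]⟩, hf (by rw [hq, hy])⟩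
  · intro x
    rw [← map_eq_zero_iff f hf, hq, hip]
    exact ⟨fun ⟨y, hy⟩ => ⟨y, Subtype.ext hy⟩, fun ⟨y, hy⟩ => ⟨y, congrArg Subtype.val hy⟩⟩

lemma HasFiniteRes.of_retract (hC : IsSemidualizing R C)
    (n : ℕ) {M N : ModuleCat.{u} R} (h : HasFiniteRes C n M)
    (ι : N →ₗ[R] M) (π : M →ₗ[R] N) (hπι : π ∘ₗ ι = LinearMap.id) : HasFiniteRes C n N := by
  induction n generalizing M N with
  | zero => exact IsCFlatCotorsion.of_retract hC h ι π hπι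
  | succ n ih =>
    obtain ⟨L, X, i, p, hi, hp, hip, hX, hL⟩ := h
    have hπ : Function.Surjective π := fun x => ⟨ι x, LinearMap.congr_fun hπι x⟩
    refine ⟨ModuleCat.of R (LinearMap.ker (π ∘ₗ p)), X, (LinearMap.ker (π ∘ₗ p)).subtype, π ∘ₗ p,
      Subtype.val_injective, hπ.comp hp, LinearMap.exact_subtype_ker_map _, hX, ?_⟩
    obtain ⟨s, hs⟩ := hL.exists_lift hC hi hp hip hX (ι ∘ₗ π ∘ₗ p)
    have hs (x) : p (s x) = ι (π (p x)) := LinearMap.congr_fun hs x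
    obtain ⟨t, ht⟩ := exists_comp_eq_of_range_le i hi (s ∘ₗ (LinearMap.ker (π ∘ₗ p)).subtype)
      fun x => (hip _).1 (by
        have : π (p x.1) = 0 := x.2
        simp [hs, this])
    have ht (x) : i (t x) = s x.1 := LinearMap.congr_fun ht x
    have hLX : HasFiniteRes C n (ModuleCat.of R (L × X)) :=
      HasFiniteRes.extension hC n (M₂ := ModuleCat.of R (L × X)) (f := LinearMap.inl R L X)
        (g := LinearMap.snd R L X) LinearMap.inl_injective LinearMap.snd_surjective
        Function.Exact.inl_snd hL (HasFiniteRes.mono (m := 0) hX (Nat.zero_le n))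
    refine ih hLX (t.prod (LinearMap.ker (π ∘ₗ p)).subtype)
      ((i.coprod (LinearMap.id - s)).codRestrict _ ?_) ?_
    · rintro ⟨l, x⟩
      have : π (ι (π (p x))) = π (p x) := LinearMap.congr_fun hπι _
      simp [hip.apply_apply_eq_zero, hs, this]
    · ext x
      simp [ht]

end FiniteResolution

/-- The class of `R`-modules of finite `C`-flat `C`-cotorsion projective
dimension is closed under extensions, cokernels of monomorphisms, and direct summands. -/
theorem stmt1 (R : Type u) [CommRing R] [IsNoetherianRing R]
    (C : ModuleCat.{u} R) (hC : IsSemidualizing R C) :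
    (∀ (M₁ M₂ M₃ : ModuleCat.{u} R) (f : ↥M₁ →ₗ[R] ↥M₂) (g : ↥M₂ →ₗ[R] ↥M₃),
        Function.Injective f → Function.Surjective g → Function.Exact f g →
        (((∃ n, HasResOfLength R (IsCFlatCotorsion R C) n M₁) →
          (∃ n, HasResOfLength R (IsCFlatCotorsion R C) n M₃) →
          (∃ n, HasResOfLength R (IsCFlatCotorsion R C) n M₂)) ∧
         ((∃ n, HasResOfLength R (IsCFlatCotorsion R C) n M₁) →
          (∃ n, HasResOfLength R (IsCFlatCotorsion R C) n M₂) →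
          (∃ n, HasResOfLength R (IsCFlatCotorsion R C) n M₃)))) ∧
    (∀ (M N : ModuleCat.{u} R), (∃ n, HasResOfLength R (IsCFlatCotorsion R C) n M) →
        (∃ (ι : ↥N →ₗ[R] ↥M) (π : ↥M →ₗ[R] ↥N), π.comp ι = LinearMap.id) →
        (∃ n, HasResOfLength R (IsCFlatCotorsion R C) n N)) := by
  refine ⟨fun M₁ M₂ M₃ f g hf hg hfg => ⟨?_, ?_⟩, ?_⟩
  · rintro ⟨m, h₁⟩ ⟨n, h₃⟩
    rw [hasResOfLength_iff] at h₁ h₃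
    exact ⟨max m n, (hasResOfLength_iff _ _).2 (HasFiniteRes.extension hC _ hf hg hfg
      (h₁.mono (le_max_left m n)) (h₃.mono (le_max_right m n)))⟩
  · rintro ⟨m, h₁⟩ ⟨n, h₂⟩
    rw [hasResOfLength_iff] at h₁ h₂
    exact ⟨max m n + 1, (hasResOfLength_iff _ _).2 (HasFiniteRes.cokernel hC _ hf hg hfg
      (h₁.mono (le_max_left m n)) (h₂.mono ((le_max_right m n).trans (Nat.le_succ _))))⟩
  · rintro M N ⟨n, h⟩ ⟨ι, π, hπι⟩
    rw [hasResOfLength_iff] at h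
    exact ⟨n, (hasResOfLength_iff _ _).2 (HasFiniteRes.of_retract hC n h ι π hπι)⟩
end
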